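/- arXiv:1012.3313 — 7 statements merged into one kernel-verified Lean document; each statement's English description precedes it below -/
import Mathlib

section
/- Assume λ(0,β,h) > 1. Then there exists a unique F^a > 0 such that λ(F^a,β,h) = 1, and the annealed free energy converges: (1/N) log Z^a_N(β,h) → F^a as N → ∞. -/
open Filter Topology Matrix

/-- Generic pinning sum: sum over the number of contacts `k`, the interarrival
times `s : Fin k → {0,…,N}` (all ≥ 1, summing to `N`) and the states
`x : Fin (k+1) → S`, of `μ0 (x 0)` times the product of the weights
`W (tᵢ − tᵢ₋₁) (xᵢ₋₁) (xᵢ)`. -/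
noncomputable def pinSum {S : Type*} [Fintype S] (μ0 : S → ℝ) (W : ℕ → S → S → ℝ)
    (N : ℕ) : ℝ :=
  ∑ k ∈ Finset.Icc 1 N, ∑ s : Fin k → Fin (N + 1),
    if (∀ i, 1 ≤ (s i : ℕ)) ∧ (∑ i, (s i : ℕ)) = N then
      ∑ x : Fin (k + 1) → S, μ0 (x 0) * ∏ i : Fin k, W (s i : ℕ) (x i.castSucc) (x i.succ)
    else 0

/-- The annealed partition function `Z^a_N(β,h)`. -/
noncomputable def Za {S : Type*} [Fintype S] [DecidableEq S] (K : ℕ → ℝ) (Q : Matrix S S ℝ)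
    (μ0 : S → ℝ) (f : S → ℝ) (β h : ℝ) (N : ℕ) : ℝ :=
  pinSum μ0 (fun t x y => K t * (Q ^ t) x y * Real.exp (β * f y + h)) N

/-- The matrix `A(b,β,h) = ∑_{t ≥ 1} M(t,β,h) e^{-bt}` where
`M(t,β,h)(x,y) = K(t) Q^t(x,y) e^{β f(y) + h}`. -/
noncomputable def Amat {S : Type*} [Fintype S] [DecidableEq S] (K : ℕ → ℝ) (Q : Matrix S S ℝ)
    (f : S → ℝ) (b β h : ℝ) : Matrix S S ℝ :=
  Matrix.of fun x y => ∑' t : ℕ,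
    K (t + 1) * (Q ^ (t + 1)) x y * Real.exp (β * f y + h) * Real.exp (-b * (t + 1))

/-- Contribution of exactly `k` jumps started from `x`. -/
noncomputable def cK {S : Type*} [Fintype S] (W : ℕ → S → S → ℝ) : ℕ → ℕ → S → ℝ
  | 0, N, _ => if N = 0 then 1 else 0
  | k + 1, N, x => ∑ t ∈ Finset.Icc 1 N, ∑ y, W t x y * cK W k (N - t) y

/-- Renewal function started from `x`. -/
noncomputable def zR {S : Type*} [Fintype S] (W : ℕ → S → S → ℝ) (N : ℕ) (x : S) : ℝ :=
  ∑ k ∈ Finset.range (N + 1), cK W k N x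

lemma sum_fin_cons {α : Type*} [Fintype α] {k : ℕ} (F : (Fin (k + 1) → α) → ℝ) :
    ∑ s, F s = ∑ a, ∑ s' : Fin k → α, F (Fin.cons a s') := by
  rw [← Fintype.sum_prod_type']
  exact (Fintype.sum_equiv (Fin.consEquiv fun _ => α) _ _ (fun _ => rfl)).symm

lemma pin_k {S : Type*} [Fintype S] (W : ℕ → S → S → ℝ) (M k : ℕ) :
    ∀ (μ : S → ℝ) (N : ℕ), N ≤ M →
    (∑ s : Fin k → Fin (M + 1),
      if (∀ i, 1 ≤ (s i : ℕ)) ∧ (∑ i, (s i : ℕ)) = N then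
        ∑ x : Fin (k + 1) → S, μ (x 0) * ∏ i : Fin k, W (s i : ℕ) (x i.castSucc) (x i.succ)
      else 0) = ∑ x, μ x * cK W k N x := by
  induction k with
  | zero =>
    intro μ N hN
    rw [Fintype.sum_unique]
    have h1 : ∀ F : (Fin 1 → S) → ℝ, ∑ x, F x = ∑ a : S, F (fun _ => a) := by
      intro F
      exact Fintype.sum_equiv (Equiv.funUnique (Fin 1) S) _ _ (fun x => by
        congr 1; ext i; rw [Subsingleton.elim i default]; rfl)
    rw [h1]
    by_cases h : N = 0
    · subst h; simp [cK]
    · simp [cK, h, Ne.symm h]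
  | succ k ih =>
    intro μ N hN
    rw [sum_fin_cons]
    have key : ∀ a : Fin (M + 1), (∑ s' : Fin k → Fin (M + 1),
        if (∀ i, 1 ≤ ((Fin.cons a s' : Fin (k + 1) → Fin (M + 1)) i : ℕ)) ∧
            (∑ i, ((Fin.cons a s' : Fin (k + 1) → Fin (M + 1)) i : ℕ)) = N then
          ∑ x : Fin (k + 1 + 1) → S, μ (x 0) * ∏ i : Fin (k + 1),
            W ((Fin.cons a s' : Fin (k + 1) → Fin (M + 1)) i : ℕ) (x i.castSucc) (x i.succ)
        else 0) =
        if (a : ℕ) ∈ Finset.Icc 1 N then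
          ∑ x, μ x * ∑ y, W (a : ℕ) x y * cK W k (N - a) y else 0 := by
      intro a
      by_cases ha : (a : ℕ) ∈ Finset.Icc 1 N
      · rw [if_pos ha]
        rw [Finset.mem_Icc] at ha
        have := ih (fun y => ∑ x0, μ x0 * W (a : ℕ) x0 y) (N - a) (by omega)
        have h2 : ∑ x, μ x * ∑ y, W (a : ℕ) x y * cK W k (N - a) y =
            ∑ y, (∑ x0, μ x0 * W (a : ℕ) x0 y) * cK W k (N - a) y := by
          simp only [Finset.mul_sum, Finset.sum_mul]
          rw [Finset.sum_comm]
          simp only [mul_assoc]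
        rw [h2, ← this]
        refine Finset.sum_congr rfl fun s' _ => ?_
        have hc : ((∀ i, 1 ≤ ((Fin.cons a s' : Fin (k + 1) → Fin (M + 1)) i : ℕ)) ∧
            (∑ i, ((Fin.cons a s' : Fin (k + 1) → Fin (M + 1)) i : ℕ)) = N) ↔
            ((∀ i, 1 ≤ (s' i : ℕ)) ∧ (∑ i, (s' i : ℕ)) = N - a) := by
          rw [Fin.forall_fin_succ, Fin.sum_univ_succ]
          simp only [Fin.cons_zero, Fin.cons_succ]
          constructor
          · rintro ⟨⟨_, h1⟩, h3⟩
            exact ⟨h1, by omega⟩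
          · rintro ⟨h1, h3⟩
            exact ⟨⟨ha.1, h1⟩, by omega⟩
        simp only [hc]
        split_ifs
        · rw [sum_fin_cons, Finset.sum_comm]
          refine Finset.sum_congr rfl fun x' _ => ?_
          rw [Finset.sum_mul]
          refine Finset.sum_congr rfl fun x0 _ => ?_
          rw [Fin.prod_univ_succ]
          simp only [Fin.cons_zero, Fin.cons_succ, Fin.castSucc_zero, ← Fin.succ_castSucc]
          ring
        · rfl
      · rw [if_neg ha]
        refine Finset.sum_eq_zero fun s' _ => ?_
        rw [if_neg]
        rintro ⟨h1, h3⟩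
        apply ha
        rw [Fin.sum_univ_succ] at h3
        have := h1 0
        simp only [Fin.cons_zero] at this h3
        rw [Finset.mem_Icc]
        omega
    rw [Finset.sum_congr rfl fun a _ => key a]
    have h4 := Fin.sum_univ_eq_sum_range (fun a : ℕ => if a ∈ Finset.Icc 1 N then
          ∑ x, μ x * ∑ y, W a x y * cK W k (N - a) y else 0) (M + 1)
    rw [h4, ← Finset.sum_filter]
    have h5 : (Finset.range (M + 1)).filter (fun a => a ∈ Finset.Icc 1 N) = Finset.Icc 1 N := by
      ext a; simp only [Finset.mem_filter, Finset.mem_range, Finset.mem_Icc]; omega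
    rw [h5, Finset.sum_comm]
    simp only [cK, Finset.mul_sum]

lemma cK_zero_of_lt {S : Type*} [Fintype S] (W : ℕ → S → S → ℝ) (k : ℕ) :
    ∀ N x, N < k → cK W k N x = 0 := by
  induction k with
  | zero => intro N x h; omega
  | succ k ih =>
    intro N x h
    simp only [cK]
    refine Finset.sum_eq_zero fun t ht => Finset.sum_eq_zero fun y _ => ?_
    rw [Finset.mem_Icc] at ht
    rw [ih _ _ (by omega), mul_zero]

lemma zR_zero {S : Type*} [Fintype S] (W : ℕ → S → S → ℝ) (x : S) : zR W 0 x = 1 := by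
  simp [zR, cK]

lemma zR_rec {S : Type*} [Fintype S] (W : ℕ → S → S → ℝ) (N : ℕ) (hN : 1 ≤ N) (x : S) :
    zR W N x = ∑ t ∈ Finset.Icc 1 N, ∑ y, W t x y * zR W (N - t) y := by
  unfold zR
  rw [Finset.sum_range_succ']
  have h0 : cK W 0 N x = 0 := by simp [cK]; omega
  rw [h0, add_zero]
  simp only [cK]
  rw [Finset.sum_comm]
  refine Finset.sum_congr rfl fun t ht => ?_
  rw [Finset.sum_comm]
  refine Finset.sum_congr rfl fun y _ => ?_
  rw [← Finset.mul_sum]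
  congr 1
  rw [Finset.mem_Icc] at ht
  symm
  apply Finset.sum_subset
  · intro a; simp only [Finset.mem_range]; omega
  · intro a _ h
    simp only [Finset.mem_range] at h
    exact cK_zero_of_lt W _ _ _ (by omega)

lemma pinSum_eq {S : Type*} [Fintype S] (W : ℕ → S → S → ℝ) (μ : S → ℝ) (N : ℕ) (hN : 1 ≤ N) :
    pinSum μ W N = ∑ x, μ x * zR W N x := by
  unfold pinSum
  rw [Finset.sum_congr rfl fun k _ => pin_k W N k μ N le_rfl, Finset.sum_comm]
  refine Finset.sum_congr rfl fun x _ => ?_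
  rw [← Finset.mul_sum]
  congr 1
  unfold zR
  apply Finset.sum_subset
  · intro a; simp only [Finset.mem_range, Finset.mem_Icc]; omega
  · intro a ha h
    simp only [Finset.mem_range, Finset.mem_Icc] at h ha
    have : a = 0 := by omega
    subst this
    simp [cK]; omega

lemma zR_pos {S : Type*} [Fintype S] (W : ℕ → S → S → ℝ)
    (hW : ∀ t, 1 ≤ t → ∀ x y, 0 ≤ W t x y) (hW1 : ∀ x, ∃ y, 0 < W 1 x y) (N : ℕ) :
    ∀ x, 0 < zR W N x := by
  induction N using Nat.strong_induction_on with
  | _ N ih =>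
    intro x
    rcases Nat.eq_zero_or_pos N with h | h
    · subst h; rw [zR_zero]; exact one_pos
    · rw [zR_rec W N h]
      have hn : ∀ t ∈ Finset.Icc 1 N, ∀ y, 0 ≤ W t x y * zR W (N - t) y := by
        intro t ht y
        rw [Finset.mem_Icc] at ht
        exact mul_nonneg (hW t ht.1 x y) (ih _ (by omega) y).le
      refine Finset.sum_pos' (fun t ht => Finset.sum_nonneg fun y _ => hn t ht y) ⟨1, ?_, ?_⟩
      · rw [Finset.mem_Icc]; omega
      · obtain ⟨y, hy⟩ := hW1 x
        exact Finset.sum_pos' (fun y _ => hn 1 (by rw [Finset.mem_Icc]; omega) y)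
          ⟨y, Finset.mem_univ _, mul_pos hy (ih _ (by omega) y)⟩

lemma icc_sum_shift (N : ℕ) (F : ℕ → ℝ) :
    ∑ t ∈ Finset.Icc 1 N, F t = ∑ t ∈ Finset.range N, F (t + 1) := by
  rw [Finset.range_eq_Ico, Finset.sum_Ico_add' F 0 N 1]
  rfl

/-- Upper bound. -/
lemma zR_upper {S : Type*} [Fintype S] (W : ℕ → S → S → ℝ)
    (hW : ∀ t, 1 ≤ t → ∀ x y, 0 ≤ W t x y) (b C : ℝ) (hC : 0 ≤ C) (ξ : S → ℝ) (hξ : ∀ x, 0 < ξ x)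
    (hC1 : ∀ x, 1 ≤ C * ξ x)
    (hA : ∀ T x, ∑ t ∈ Finset.range T, ∑ y, W (t + 1) x y * Real.exp (-b * (t + 1)) * ξ y ≤ ξ x)
    (N : ℕ) : ∀ x, zR W N x ≤ C * Real.exp (b * N) * ξ x := by
  induction N using Nat.strong_induction_on with
  | _ N ih =>
    intro x
    rcases Nat.eq_zero_or_pos N with h | h
    · subst h; rw [zR_zero]; simpa using hC1 x
    · rw [zR_rec W N h, icc_sum_shift]
      calc _ ≤ ∑ t ∈ Finset.range N, ∑ y, (C * Real.exp (b * N)) *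
            (W (t + 1) x y * Real.exp (-b * (t + 1)) * ξ y) := by
            refine Finset.sum_le_sum fun t ht => Finset.sum_le_sum fun y _ => ?_
            rw [Finset.mem_range] at ht
            have h1 := mul_le_mul_of_nonneg_left (ih (N - (t + 1)) (by omega) y)
              (hW (t + 1) (by omega) x y)
            refine h1.trans (le_of_eq ?_)
            have : Real.exp (b * ((N - (t + 1) : ℕ) : ℝ)) =
                Real.exp (b * N) * Real.exp (-b * (t + 1)) := by
              rw [← Real.exp_add]; congr 1
              rw [Nat.cast_sub (by omega)]; push_cast; ring
            rw [this]; ring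
        _ ≤ _ := by
            simp only [← Finset.mul_sum]
            exact mul_le_mul_of_nonneg_left (hA N x) (by positivity)

/-- Lower bound. -/
lemma zR_lower {S : Type*} [Fintype S] (W : ℕ → S → S → ℝ)
    (hW : ∀ t, 1 ≤ t → ∀ x y, 0 ≤ W t x y) (hW1 : ∀ x, ∃ y, 0 < W 1 x y)
    (b c : ℝ) (hc : 0 ≤ c) (ξ : S → ℝ) (hξ : ∀ x, 0 < ξ x) (T : ℕ) (hT : 1 ≤ T)
    (hc1 : ∀ N < T, ∀ x, c * Real.exp (b * N) * ξ x ≤ zR W N x)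
    (hA : ∀ x, ξ x ≤ ∑ t ∈ Finset.range T, ∑ y, W (t + 1) x y * Real.exp (-b * (t + 1)) * ξ y)
    (N : ℕ) : ∀ x, c * Real.exp (b * N) * ξ x ≤ zR W N x := by
  induction N using Nat.strong_induction_on with
  | _ N ih =>
    intro x
    rcases lt_or_ge N T with h | h
    · exact hc1 N h x
    · rw [zR_rec W N (by omega), icc_sum_shift]
      calc _ ≤ ∑ t ∈ Finset.range T, ∑ y, (c * Real.exp (b * N)) *
            (W (t + 1) x y * Real.exp (-b * (t + 1)) * ξ y) := by
            simp only [← Finset.mul_sum]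
            exact mul_le_mul_of_nonneg_left (hA x) (by positivity)
        _ ≤ ∑ t ∈ Finset.range T, ∑ y, W (t + 1) x y * zR W (N - (t + 1)) y := by
            refine Finset.sum_le_sum fun t ht => Finset.sum_le_sum fun y _ => ?_
            rw [Finset.mem_range] at ht
            have h1 := mul_le_mul_of_nonneg_left (ih (N - (t + 1)) (by omega) y)
              (hW (t + 1) (by omega) x y)
            refine (le_of_eq ?_).trans h1
            have : Real.exp (b * ((N - (t + 1) : ℕ) : ℝ)) =
                Real.exp (b * N) * Real.exp (-b * (t + 1)) := by
              rw [← Real.exp_add]; congr 1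
              rw [Nat.cast_sub (by omega)]; push_cast; ring
            rw [this]; ring
        _ ≤ _ := by
            refine Finset.sum_le_sum_of_subset_of_nonneg ?_ ?_
            · intro a; simp only [Finset.mem_range]; omega
            · intro t _ _
              exact Finset.sum_nonneg fun y _ => mul_nonneg (hW _ (by omega) x y)
                (zR_pos W hW hW1 _ y).le

lemma cw_le {S : Type*} [Fintype S] [Nonempty S] (A : Matrix S S ℝ) (hA : ∀ x y, 0 ≤ A x y)
    (η ξ : S → ℝ) (hη : ∀ x, 0 < η x) (hξ : ∀ x, 0 < ξ x) (m c : ℝ)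
    (h1 : ∀ x, m * η x ≤ (A *ᵥ η) x) (h2 : ∀ x, (A *ᵥ ξ) x ≤ c * ξ x) : m ≤ c := by
  obtain ⟨x, hx⟩ := Finite.exists_max (fun x => η x / ξ x)
  set r := η x / ξ x with hr
  have hrp : 0 < r := div_pos (hη x) (hξ x)
  have hle : ∀ y, η y ≤ r * ξ y := fun y => (div_le_iff₀ (hξ y)).1 (hx y)
  have heq : η x = r * ξ x := by rw [hr]; field_simp [(hξ x).ne']
  have h3 : (A *ᵥ η) x ≤ r * (A *ᵥ ξ) x := by
    simp only [Matrix.mulVec, dotProduct, Finset.mul_sum]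
    refine Finset.sum_le_sum fun y _ => ?_
    have := mul_le_mul_of_nonneg_left (hle y) (hA x y)
    linarith
  have h4 := h1 x
  have h5 := mul_le_mul_of_nonneg_left (h2 x) hrp.le
  have h6 : m * (r * ξ x) ≤ c * (r * ξ x) := by
    rw [heq] at h4; linarith
  exact le_of_mul_le_mul_right h6 (mul_pos hrp (hξ x))

theorem main_abs {S : Type*} [Fintype S] [Nonempty S] (W : ℕ → S → S → ℝ)
    (hW : ∀ t, 1 ≤ t → ∀ x y, 0 ≤ W t x y) (hW1 : ∀ x, ∃ y, 0 < W 1 x y)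
    (hs : ∀ b : ℝ, 0 ≤ b → ∀ x y, Summable fun t : ℕ => W (t + 1) x y * Real.exp (-b * (t + 1)))
    (μ0 : S → ℝ) (hμ0 : ∀ x, 0 ≤ μ0 x) (hμ1 : ∑ x, μ0 x = 1)
    (A : ℝ → Matrix S S ℝ)
    (hA : ∀ b x y, A b x y = ∑' t : ℕ, W (t + 1) x y * Real.exp (-b * (t + 1)))
    (lam : ℝ → ℝ)
    (hlam : ∀ b : ℝ, 0 ≤ b → ∃ ξ : S → ℝ, (∀ x, 0 < ξ x) ∧ (A b) *ᵥ ξ = lam b • ξ)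
    (hlam0 : 1 < lam 0) :
    ∃ Fa : ℝ, 0 < Fa ∧ lam Fa = 1 ∧ (∀ b, 0 < b → lam b = 1 → b = Fa) ∧
      Tendsto (fun N : ℕ => Real.log (pinSum μ0 W N) / N) atTop (𝓝 Fa) := by
  have hterm : ∀ b x y (t : ℕ), 0 ≤ W (t + 1) x y * Real.exp (-b * (t + 1)) := fun b x y t =>
    mul_nonneg (hW _ (by omega) x y) (Real.exp_pos _).le
  have hA0 : ∀ b x y, 0 ≤ A b x y := fun b x y => by
    rw [hA]; exact tsum_nonneg (hterm b x y)
  choose! ξ hξ hev using hlam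
  have hev' : ∀ b, 0 ≤ b → ∀ x, (A b *ᵥ ξ b) x = lam b * ξ b x := fun b hb x => by
    rw [hev b hb]; rfl
  -- truncated sums
  have htr : ∀ b, 0 ≤ b → ∀ (η : S → ℝ) x, HasSum
      (fun t : ℕ => ∑ y, W (t + 1) x y * Real.exp (-b * (t + 1)) * η y) ((A b *ᵥ η) x) := by
    intro b hb η x
    simp only [Matrix.mulVec, dotProduct]
    refine hasSum_sum fun y _ => ?_
    rw [hA]
    exact (hs b hb x y).hasSum.mul_right _
  -- positivity of lam
  have hlpos : ∀ b, 0 ≤ b → 0 < lam b := by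
    intro b hb
    obtain ⟨x⟩ := ‹Nonempty S›
    obtain ⟨y, hy⟩ := hW1 x
    have h1 : 0 < A b x y := by
      rw [hA]
      exact (hs b hb x y).tsum_pos (hterm b x y) 0 (mul_pos (by simpa using hy) (Real.exp_pos _))
    have h2 : 0 < (A b *ᵥ ξ b) x := by
      simp only [Matrix.mulVec, dotProduct]
      exact Finset.sum_pos' (fun z _ => mul_nonneg (hA0 b x z) (hξ b hb z).le)
        ⟨y, Finset.mem_univ _, mul_pos h1 (hξ b hb y)⟩
    rw [hev' b hb] at h2
    exact (pos_iff_pos_of_mul_pos h2).2 (hξ b hb x)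
  -- exponential decay
  have hdec : ∀ b b', 0 ≤ b → b ≤ b' → lam b' ≤ Real.exp (-(b' - b)) * lam b := by
    intro b b' hb hbb
    have hb' : 0 ≤ b' := hb.trans hbb
    refine cw_le (A b') (hA0 b') (ξ b') (ξ b) (hξ b' hb') (hξ b hb) _ _
      (fun x => (hev' b' hb' x).ge) (fun x => ?_)
    rw [mul_assoc, ← hev' b hb]
    simp only [Matrix.mulVec, dotProduct, Finset.mul_sum]
    refine Finset.sum_le_sum fun y _ => ?_
    rw [← mul_assoc]
    refine mul_le_mul_of_nonneg_right ?_ (hξ b hb y).le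
    rw [hA, hA, ← tsum_mul_left]
    refine (hs b' hb' x y).tsum_le_tsum (fun t => ?_) ((hs b hb x y).mul_left _)
    have : Real.exp (-b' * (t + 1)) ≤ Real.exp (-(b' - b)) * Real.exp (-b * (t + 1)) := by
      rw [← Real.exp_add]
      apply Real.exp_le_exp.2
      have : 0 ≤ (b' - b) * t := mul_nonneg (by linarith) (Nat.cast_nonneg t)
      linarith
    have := mul_le_mul_of_nonneg_left this (hW (t + 1) (by omega) x y)
    linarith
  have hanti : ∀ b b', 0 ≤ b → b < b' → lam b' < lam b := by
    intro b b' hb hbb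
    refine (hdec b b' hb hbb.le).trans_lt ?_
    have : Real.exp (-(b' - b)) < 1 := Real.exp_lt_one_iff.2 (by linarith)
    have := mul_lt_mul_of_pos_right this (hlpos b hb)
    linarith
  -- continuity
  have hAc : ∀ x y, ContinuousOn (fun b => A b x y) (Set.Ici 0) := by
    intro x y
    simp only [hA]
    refine continuousOn_tsum (u := fun t : ℕ => W (t + 1) x y * Real.exp (-0 * (t + 1)))
      (fun t => by fun_prop) (hs 0 le_rfl x y) ?_
    intro t b hb
    rw [Real.norm_of_nonneg (hterm b x y t)]
    refine mul_le_mul_of_nonneg_left (Real.exp_le_exp.2 ?_) (hW _ (by omega) x y)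
    have hb : 0 ≤ b := hb
    have : 0 ≤ b * (t + 1) := by positivity
    linarith
  have hcont : ContinuousOn lam (Set.Ici 0) := by
    intro b hb
    have hb0 : 0 ≤ b := hb
    have hv : ∀ x, Tendsto (fun b' => (A b' *ᵥ ξ b) x) (𝓝[Set.Ici 0] b)
        (𝓝 (lam b * ξ b x)) := by
      intro x
      rw [← hev' b hb0]
      simp only [Matrix.mulVec, dotProduct]
      exact tendsto_finsetSum _ fun y _ => (hAc x y b hb).mul_const _
    refine tendsto_order.2 ⟨fun a ha => ?_, fun a ha => ?_⟩
    · obtain ⟨a', h1, h2⟩ := exists_between ha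
      have : ∀ᶠ b' in 𝓝[Set.Ici 0] b, ∀ x, a' * ξ b x < (A b' *ᵥ ξ b) x :=
        eventually_all.2 fun x => (hv x).eventually_const_lt
          (mul_lt_mul_of_pos_right h2 (hξ b hb0 x))
      filter_upwards [this, self_mem_nhdsWithin] with b' hb' hb'0
      exact h1.trans_le (cw_le (A b') (hA0 b') (ξ b) (ξ b') (hξ b hb0) (hξ b' hb'0) _ _
        (fun x => (hb' x).le) (fun x => (hev' b' hb'0 x).le))
    · obtain ⟨a', h1, h2⟩ := exists_between ha
      have : ∀ᶠ b' in 𝓝[Set.Ici 0] b, ∀ x, (A b' *ᵥ ξ b) x < a' * ξ b x :=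
        eventually_all.2 fun x => (hv x).eventually_lt_const
          (mul_lt_mul_of_pos_right h1 (hξ b hb0 x))
      filter_upwards [this, self_mem_nhdsWithin] with b' hb' hb'0
      exact (cw_le (A b') (hA0 b') (ξ b') (ξ b) (hξ b' hb'0) (hξ b hb0) _ _
        (fun x => (hev' b' hb'0 x).ge) (fun x => (hb' x).le)).trans_lt h2
  -- root
  obtain ⟨Fa, hFa0, hFa⟩ : ∃ Fa, 0 ≤ Fa ∧ lam Fa = 1 := by
    set B := Real.log (lam 0)
    have hB : 0 ≤ B := Real.log_nonneg hlam0.le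
    have hl : lam B ≤ 1 := by
      have := hdec 0 B le_rfl hB
      rwa [sub_zero, Real.exp_neg, Real.exp_log (hlpos 0 le_rfl),
        inv_mul_cancel₀ (hlpos 0 le_rfl).ne'] at this
    obtain ⟨F, hF, hF1⟩ := intermediate_value_Icc' hB
      (hcont.mono Set.Icc_subset_Ici_self) ⟨hl, hlam0.le⟩
    exact ⟨F, hF.1, hF1⟩
  have hFpos : 0 < Fa := by
    rcases hFa0.eq_or_lt with h | h
    · rw [← h] at hFa; linarith
    · exact h
  refine ⟨Fa, hFpos, hFa, ?_, ?_⟩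
  · intro b hb hb1
    rcases lt_trichotomy b Fa with h | h | h
    · have := hanti b Fa hb.le h; linarith
    · exact h
    · have := hanti Fa b hFa0 h; linarith
  -- partition function bounds
  have hZ : ∀ N, 1 ≤ N → pinSum μ0 W N = ∑ x, μ0 x * zR W N x := fun N hN => pinSum_eq W μ0 N hN
  have hup : ∃ C, 0 < C ∧ ∀ N : ℕ, 1 ≤ N → pinSum μ0 W N ≤ C * Real.exp (Fa * N) := by
    obtain ⟨x0, hx0⟩ := Finite.exists_min (ξ Fa)
    obtain ⟨x1, hx1⟩ := Finite.exists_max (ξ Fa)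
    have p0 := hξ Fa hFa0 x0
    have p1 := hξ Fa hFa0 x1
    refine ⟨(ξ Fa x0)⁻¹ * ξ Fa x1, by positivity, fun N hN => ?_⟩
    have hz := zR_upper W hW Fa (ξ Fa x0)⁻¹ (by positivity) (ξ Fa) (hξ Fa hFa0)
      (fun x => by
        rw [← inv_mul_cancel₀ p0.ne']
        exact mul_le_mul_of_nonneg_left (hx0 x) (by positivity))
      (fun T x => by
        have h1 := htr Fa hFa0 (ξ Fa) x
        rw [hev' Fa hFa0, hFa, one_mul] at h1
        exact sum_le_hasSum _ (fun t _ => Finset.sum_nonneg fun y _ =>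
          mul_nonneg (hterm Fa x y t) (hξ Fa hFa0 y).le) h1) N
    rw [hZ N hN]
    calc _ ≤ ∑ x, μ0 x * ((ξ Fa x0)⁻¹ * ξ Fa x1 * Real.exp (Fa * N)) := by
          refine Finset.sum_le_sum fun x _ => mul_le_mul_of_nonneg_left ((hz x).trans ?_) (hμ0 x)
          rw [mul_right_comm]
          refine mul_le_mul_of_nonneg_right ?_ (Real.exp_pos _).le
          exact mul_le_mul_of_nonneg_left (hx1 x) (by positivity)
      _ = _ := by rw [← Finset.sum_mul, hμ1, one_mul]
  have hlow : ∀ b, 0 ≤ b → b < Fa → ∃ c, 0 < c ∧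
      ∀ N : ℕ, 1 ≤ N → c * Real.exp (b * N) ≤ pinSum μ0 W N := by
    intro b hb hbF
    have hl : 1 < lam b := by have := hanti b Fa hb hbF; linarith
    obtain ⟨x0, hx0⟩ := Finite.exists_min (ξ b)
    have p0 := hξ b hb x0
    obtain ⟨T, hT, hT1⟩ : ∃ T, 1 ≤ T ∧ ∀ x, ξ b x ≤ ∑ t ∈ Finset.range T,
        ∑ y, W (t + 1) x y * Real.exp (-b * (t + 1)) * ξ b y := by
      have : ∀ᶠ T : ℕ in atTop, ∀ x, ξ b x < ∑ t ∈ Finset.range T,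
          ∑ y, W (t + 1) x y * Real.exp (-b * (t + 1)) * ξ b y := by
        refine eventually_all.2 fun x => ?_
        refine (htr b hb (ξ b) x).tendsto_sum_nat.eventually_const_lt ?_
        rw [hev' b hb]
        have := mul_lt_mul_of_pos_right hl (hξ b hb x)
        linarith
      obtain ⟨T, h1, h2⟩ := (this.and (eventually_ge_atTop 1)).exists
      exact ⟨T, h2, fun x => (h1 x).le⟩
    haveI : Nonempty (Fin T) := ⟨⟨0, by omega⟩⟩
    obtain ⟨p, hp⟩ := Finite.exists_min (fun p : Fin T × S =>
      zR W p.1 p.2 / (Real.exp (b * ((p.1 : ℕ) : ℝ)) * ξ b p.2))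
    set c := zR W p.1 p.2 / (Real.exp (b * ((p.1 : ℕ) : ℝ)) * ξ b p.2) with hcdef
    have hc : 0 < c := div_pos (zR_pos W hW hW1 _ _) (mul_pos (Real.exp_pos _) (hξ b hb _))
    have hz := zR_lower W hW hW1 b c hc.le (ξ b) (hξ b hb) T hT (fun N hN x => by
      have := hp (⟨N, hN⟩, x)
      rw [mul_assoc]
      exact (le_div_iff₀ (mul_pos (Real.exp_pos _) (hξ b hb _))).1 this) hT1
    refine ⟨c * ξ b x0, by positivity, fun N hN => ?_⟩
    rw [hZ N hN]
    calc _ = ∑ x, μ0 x * (c * ξ b x0 * Real.exp (b * N)) := by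
          rw [← Finset.sum_mul, hμ1, one_mul]
      _ ≤ _ := by
          refine Finset.sum_le_sum fun x _ => mul_le_mul_of_nonneg_left (le_trans ?_ (hz N x)) (hμ0 x)
          rw [mul_right_comm]
          exact mul_le_mul_of_nonneg_left (hx0 x) (by positivity)
  have hlim : ∀ c b : ℝ, Tendsto (fun N : ℕ => Real.log c / N + b) atTop (𝓝 b) := by
    intro c b
    have := (tendsto_const_div_atTop_nhds_zero_nat (Real.log c)).add_const b
    rwa [zero_add] at this
  have hlog : ∀ (c b : ℝ) (N : ℕ), 0 < c → 1 ≤ N →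
      Real.log (c * Real.exp (b * N)) / N = Real.log c / N + b := by
    intro c b N hc hN
    have : (N : ℝ) ≠ 0 := by positivity
    rw [Real.log_mul hc.ne' (Real.exp_pos _).ne', Real.log_exp]
    field_simp
  have hlowb : ∀ b, 0 ≤ b → b < Fa → ∀ a < b,
      ∀ᶠ N : ℕ in atTop, a < Real.log (pinSum μ0 W N) / N := by
    intro b hb0 hbF a hab
    obtain ⟨c, hc, hcN⟩ := hlow b hb0 hbF
    filter_upwards [(hlim c b).eventually_const_lt hab, eventually_ge_atTop 1] with N h1 hN
    refine h1.trans_le ?_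
    rw [← hlog c b N hc hN]
    exact div_le_div_of_nonneg_right (Real.log_le_log (by positivity) (hcN N hN))
      (Nat.cast_nonneg N)
  refine tendsto_order.2 ⟨fun a ha => ?_, fun a ha => ?_⟩
  · obtain ⟨b, h1, h2⟩ := exists_between (max_lt ha hFpos)
    exact hlowb b ((le_max_right _ _).trans h1.le) h2 a ((le_max_left _ _).trans_lt h1)
  · obtain ⟨C, hC, hCN⟩ := hup
    obtain ⟨c, hc, hcN⟩ := hlow 0 le_rfl hFpos
    filter_upwards [(hlim C Fa).eventually_lt_const ha, eventually_ge_atTop 1] with N h1 hN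
    refine lt_of_le_of_lt ?_ h1
    rw [← hlog C Fa N hC hN]
    exact div_le_div_of_nonneg_right (Real.log_le_log
      (lt_of_lt_of_le (by positivity) (hcN N hN)) (hCN N hN)) (Nat.cast_nonneg N)

/-- If `λ(0,β,h) > 1` then there is a unique `Fᵃ > 0` with
`λ(Fᵃ,β,h) = 1`, and `(1/N) log Z^a_N(β,h) → Fᵃ`.  Here `lam b` is the
Perron–Frobenius eigenvalue of `A(b,β,h)`, characterized as the eigenvalue
admitting an entrywise positive right eigenvector. -/
theorem statement0 {S : Type*} [Fintype S] [DecidableEq S] [Nonempty S]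
    (K : ℕ → ℝ) (hKpos : ∀ n, 1 ≤ n → 0 < K n) (hKsum : ∑' n : ℕ, K (n + 1) = 1)
    (Q : Matrix S S ℝ) (hQ0 : ∀ x y, 0 ≤ Q x y) (hQ1 : ∀ x, ∑ y, Q x y = 1)
    (hQirr : ∀ x y, ∃ t, 1 ≤ t ∧ 0 < (Q ^ t) x y)
    (μ0 : S → ℝ) (hμ0 : ∀ x, 0 ≤ μ0 x) (hμ1 : ∑ x, μ0 x = 1)
    (hμinv : ∀ y, ∑ x, μ0 x * Q x y = μ0 y)
    (f : S → ℝ) (β h : ℝ) (hβ : 0 ≤ β)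
    (hAsum : ∀ b : ℝ, 0 ≤ b → ∀ x y : S, Summable fun t : ℕ =>
      K (t + 1) * (Q ^ (t + 1)) x y * Real.exp (β * f y + h) * Real.exp (-b * (t + 1)))
    (lam : ℝ → ℝ)
    (hlam : ∀ b : ℝ, 0 ≤ b → ∃ ξ : S → ℝ, (∀ x, 0 < ξ x) ∧
      (Amat K Q f b β h) *ᵥ ξ = lam b • ξ)
    (hlam0 : 1 < lam 0) :
    ∃ Fa : ℝ, 0 < Fa ∧ lam Fa = 1 ∧ (∀ b, 0 < b → lam b = 1 → b = Fa) ∧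
      Tendsto (fun N : ℕ => Real.log (Za K Q μ0 f β h N) / N) atTop (𝓝 Fa) := by
  have hQn : ∀ t x y, 0 ≤ (Q ^ t) x y := by
    intro t
    induction t with
    | zero => intro x y; rw [pow_zero, Matrix.one_apply]; split_ifs <;> norm_num
    | succ t ih =>
      intro x y
      rw [pow_succ, Matrix.mul_apply]
      exact Finset.sum_nonneg fun z _ => mul_nonneg (ih x z) (hQ0 z y)
  refine main_abs (fun t x y => K t * (Q ^ t) x y * Real.exp (β * f y + h)) ?_ ?_ hAsum μ0 hμ0 hμ1
    (fun b => Amat K Q f b β h) (fun b x y => rfl) lam hlam hlam0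
  · intro t ht x y
    exact mul_nonneg (mul_nonneg (hKpos t ht).le (hQn t x y)) (Real.exp_pos _).le
  · intro x
    have : ∃ y, 0 < Q x y := by
      by_contra hcon
      push Not at hcon
      have h1 := hQ1 x
      have h2 : ∑ y, Q x y ≤ 0 := Finset.sum_nonpos fun y _ => hcon y
      linarith
    obtain ⟨y, hy⟩ := this
    refine ⟨y, ?_⟩
    simp only [pow_one]
    exact mul_pos (mul_pos (hKpos 1 le_rfl) hy) (Real.exp_pos _)
end

section
/- Assume λ(0,β,h) ≤ 1 and that (1/N) log K(N) → 0 as N → ∞. Then (1/N) log Z^a_N(β,h) → 0 as N → ∞. -/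
open Filter Topology Matrix

lemma pow_nonneg_aux {S : Type*} [Fintype S] [DecidableEq S] (Q : Matrix S S ℝ)
    (hQ0 : ∀ x y, 0 ≤ Q x y) (n : ℕ) : ∀ x y, 0 ≤ (Q ^ n) x y := by
  induction n with
  | zero =>
    intro x y
    rw [pow_zero, Matrix.one_apply]
    split_ifs <;> norm_num
  | succ n ih =>
    intro x y
    rw [pow_succ, Matrix.mul_apply]
    exact Finset.sum_nonneg fun z _ => mul_nonneg (ih x z) (hQ0 z y)

lemma pow_row_aux {S : Type*} [Fintype S] [DecidableEq S] (Q : Matrix S S ℝ)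
    (hQ1 : ∀ x, ∑ y, Q x y = 1) (n : ℕ) : ∀ x, ∑ y, (Q ^ n) x y = 1 := by
  induction n with
  | zero =>
    intro x
    simp [Matrix.one_apply]
  | succ n ih =>
    intro x
    simp_rw [pow_succ, Matrix.mul_apply]
    rw [Finset.sum_comm]
    simp_rw [← Finset.mul_sum, hQ1, mul_one]
    exact ih x

lemma chain_aux {S : Type*} [Fintype S] (B : S → S → ℝ) (hB : ∀ x y, 0 ≤ B x y)
    (ξ : S → ℝ) (hBξ : ∀ x, ∑ y, B x y * ξ y ≤ ξ x) (k : ℕ) :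
    ∀ g : S → ℝ, (∀ x, 0 ≤ g x) →
      ∑ x : Fin (k + 1) → S, g (x 0) * (∏ i : Fin k, B (x i.castSucc) (x i.succ)) *
        ξ (x (Fin.last k)) ≤ ∑ x, g x * ξ x := by
  induction k with
  | zero =>
    intro g hg
    rw [← (Equiv.funUnique (Fin 1) S).symm.sum_comp]
    simp
  | succ k ih =>
    intro g hg
    have h1 := ih (fun y => ∑ a, g a * B a y)
      (fun y => Finset.sum_nonneg fun a _ => mul_nonneg (hg a) (hB a y))
    rw [← (Fin.consEquiv (fun _ : Fin (k + 2) => S)).sum_comp, Fintype.sum_prod_type,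
      Finset.sum_comm]
    calc _ = ∑ y : Fin (k + 1) → S, (∑ a, g a * B a (y 0)) *
          (∏ i : Fin k, B (y i.castSucc) (y i.succ)) * ξ (y (Fin.last k)) := by
          refine Finset.sum_congr rfl fun y _ => ?_
          rw [Finset.sum_mul, Finset.sum_mul]
          refine Finset.sum_congr rfl fun a _ => ?_
          rw [Fin.prod_univ_succ]
          simp only [Fin.consEquiv_apply, Fin.cons_zero, Fin.castSucc_zero, Fin.cons_succ,
            ← Fin.succ_last, ← Fin.succ_castSucc]
          ring
      _ ≤ _ := h1
      _ = ∑ a, g a * ∑ y, B a y * ξ y := by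
          simp_rw [Finset.sum_mul, Finset.mul_sum]
          rw [Finset.sum_comm]
          simp_rw [mul_assoc]
      _ ≤ _ := Finset.sum_le_sum fun a _ => mul_le_mul_of_nonneg_left (hBξ a) (hg a)

lemma pinSum_le_aux {S : Type*} [Fintype S] [Nonempty S] (μ0 : S → ℝ) (hμ0 : ∀ x, 0 ≤ μ0 x)
    (W : ℕ → S → S → ℝ) (hW : ∀ t, 1 ≤ t → ∀ x y, 0 ≤ W t x y)
    (ξ : S → ℝ) (hξ : ∀ x, 0 < ξ x)
    (hWξ : ∀ N x, ∑ y, (∑ t ∈ Finset.range N, W (t + 1) x y) * ξ y ≤ ξ x) :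
    ∃ C : ℝ, ∀ N, pinSum μ0 W N ≤ N * C := by
  obtain ⟨z, hz⟩ := Finite.exists_min ξ
  refine ⟨(∑ x, μ0 x * ξ x) / ξ z, fun N => ?_⟩
  have key : ∀ k ∈ Finset.Icc 1 N, (∑ s : Fin k → Fin (N + 1),
    if (∀ i, 1 ≤ (s i : ℕ)) ∧ (∑ i, (s i : ℕ)) = N then
      ∑ x : Fin (k + 1) → S, μ0 (x 0) * ∏ i : Fin k, W (s i : ℕ) (x i.castSucc) (x i.succ)
    else 0) ≤ (∑ x, μ0 x * ξ x) / ξ z := by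
    intro k _
    set V : Fin (N + 1) → S → S → ℝ := fun t x y => if 1 ≤ (t : ℕ) then W t x y else 0 with hV
    have hV0 : ∀ t x y, 0 ≤ V t x y := by
      intro t x y
      simp only [hV]
      split_ifs with h1
      · exact hW _ h1 x y
      · exact le_rfl
    have hVs : ∀ x y, ∑ t, V t x y = ∑ t ∈ Finset.range N, W (t + 1) x y := by
      intro x y
      rw [Fin.sum_univ_succ]
      simp [hV, Finset.sum_range]
    rw [le_div_iff₀ (hξ z)]
    have h1 := chain_aux (fun x y => ∑ t, V t x y)
      (fun x y => Finset.sum_nonneg fun t _ => hV0 t x y) ξ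
      (fun x => by simp_rw [hVs]; exact hWξ N x) k μ0 hμ0
    refine le_trans ?_ h1
    have h2 : ∀ s : Fin k → Fin (N + 1), (if (∀ i, 1 ≤ (s i : ℕ)) ∧ (∑ i, (s i : ℕ)) = N then
      ∑ x : Fin (k + 1) → S, μ0 (x 0) * ∏ i : Fin k, W (s i : ℕ) (x i.castSucc) (x i.succ)
      else 0) ≤ ∑ x : Fin (k + 1) → S, μ0 (x 0) * ∏ i : Fin k, V (s i) (x i.castSucc) (x i.succ) := by
      intro s
      split_ifs with hs
      · refine le_of_eq (Finset.sum_congr rfl fun x _ => ?_)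
        congr 1
        refine Finset.prod_congr rfl fun i _ => ?_
        simp only [hV, if_pos (hs.1 i)]
      · exact Finset.sum_nonneg fun x _ => mul_nonneg (hμ0 _)
          (Finset.prod_nonneg fun i _ => hV0 _ _ _)
    refine le_trans (mul_le_mul_of_nonneg_right (Finset.sum_le_sum fun s _ => h2 s) (hξ z).le) ?_
    rw [Finset.sum_comm, Finset.sum_mul]
    refine Finset.sum_le_sum fun x _ => ?_
    rw [← Finset.mul_sum, Finset.prod_univ_sum, Fintype.piFinset_univ]
    exact mul_le_mul_of_nonneg_left (hz _) (mul_nonneg (hμ0 _)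
      (Finset.sum_nonneg fun s _ => Finset.prod_nonneg fun i _ => hV0 _ _ _))
  unfold pinSum
  refine (Finset.sum_le_sum key).trans ?_
  simp

lemma le_pinSum_aux {S : Type*} [Fintype S] (μ0 : S → ℝ) (hμ0 : ∀ x, 0 ≤ μ0 x)
    (W : ℕ → S → S → ℝ) (hW : ∀ t, 1 ≤ t → ∀ x y, 0 ≤ W t x y) (N : ℕ) (hN : 1 ≤ N) :
    ∑ x, ∑ y, μ0 x * W N x y ≤ pinSum μ0 W N := by
  have h0 : ∀ k, ∀ s : Fin k → Fin (N + 1),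
    0 ≤ (if (∀ i, 1 ≤ (s i : ℕ)) ∧ (∑ i, (s i : ℕ)) = N then
      ∑ x : Fin (k + 1) → S, μ0 (x 0) * ∏ i : Fin k, W (s i : ℕ) (x i.castSucc) (x i.succ)
    else 0) := by
    intro k s
    split_ifs with hs
    · exact Finset.sum_nonneg fun x _ => mul_nonneg (hμ0 _)
          (Finset.prod_nonneg fun i _ => hW _ (hs.1 i) _ _)
    · exact le_rfl
  unfold pinSum
  refine le_trans ?_ (Finset.single_le_sum (fun k _ => Finset.sum_nonneg fun s _ => h0 k s)
    (Finset.mem_Icc.2 ⟨le_rfl, hN⟩))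
  refine le_trans ?_ (Finset.single_le_sum (fun s _ => h0 1 s)
    (Finset.mem_univ (fun _ => Fin.last N)))
  rw [if_pos (by simpa using hN)]
  rw [← (finTwoArrowEquiv S).symm.sum_comp, Fintype.sum_prod_type]
  simp

/-- If `λ(0,β,h) ≤ 1` and `(1/N) log K(N) → 0`, then
`(1/N) log Z^a_N(β,h) → 0`. -/
theorem statement1 {S : Type*} [Fintype S] [DecidableEq S] [Nonempty S]
    (K : ℕ → ℝ) (hKpos : ∀ n, 1 ≤ n → 0 < K n) (hKsum : ∑' n : ℕ, K (n + 1) = 1)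
    (hK : Tendsto (fun N : ℕ => Real.log (K N) / N) atTop (𝓝 0))
    (Q : Matrix S S ℝ) (hQ0 : ∀ x y, 0 ≤ Q x y) (hQ1 : ∀ x, ∑ y, Q x y = 1)
    (hQirr : ∀ x y, ∃ t, 1 ≤ t ∧ 0 < (Q ^ t) x y)
    (μ0 : S → ℝ) (hμ0 : ∀ x, 0 ≤ μ0 x) (hμ1 : ∑ x, μ0 x = 1)
    (hμinv : ∀ y, ∑ x, μ0 x * Q x y = μ0 y)
    (f : S → ℝ) (β h : ℝ) (hβ : 0 ≤ β)
    (hAsum : ∀ b : ℝ, 0 ≤ b → ∀ x y : S, Summable fun t : ℕ =>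
      K (t + 1) * (Q ^ (t + 1)) x y * Real.exp (β * f y + h) * Real.exp (-b * (t + 1)))
    (lam : ℝ → ℝ)
    (hlam : ∀ b : ℝ, 0 ≤ b → ∃ ξ : S → ℝ, (∀ x, 0 < ξ x) ∧
      (Amat K Q f b β h) *ᵥ ξ = lam b • ξ)
    (hlam0 : lam 0 ≤ 1) :
    Tendsto (fun N : ℕ => Real.log (Za K Q μ0 f β h N) / N) atTop (𝓝 0) := by
  have hQn := pow_nonneg_aux Q hQ0
  have hW : ∀ t, 1 ≤ t → ∀ x y, 0 ≤ K t * (Q ^ t) x y * Real.exp (β * f y + h) :=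
    fun t ht x y => mul_nonneg (mul_nonneg (hKpos t ht).le (hQn t x y)) (Real.exp_pos _).le
  obtain ⟨ξ, hξ, hAξ⟩ := hlam 0 le_rfl
  obtain ⟨C, hC⟩ := pinSum_le_aux μ0 hμ0
    (fun t x y => K t * (Q ^ t) x y * Real.exp (β * f y + h)) hW ξ hξ (by
      intro N x
      have h1 := congrFun hAξ x
      rw [Matrix.mulVec, dotProduct] at h1
      simp only [Pi.smul_apply, smul_eq_mul] at h1
      have h2 : lam 0 * ξ x ≤ ξ x := mul_le_of_le_one_left (hξ x).le hlam0
      refine le_trans (Finset.sum_le_sum fun y _ => ?_) (h1.trans_le h2)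
      refine mul_le_mul_of_nonneg_right ?_ (hξ y).le
      have h3 := hAsum 0 le_rfl x y
      have h4 := h3.sum_le_tsum (Finset.range N) (fun t _ =>
        mul_nonneg (hW (t + 1) (by omega) x y) (Real.exp_pos _).le)
      simpa [Amat] using h4)
  obtain ⟨z, hz⟩ := Finite.exists_min (fun y => Real.exp (β * f y + h))
  set c := Real.exp (β * f z + h) with hc
  have hcpos : 0 < c := Real.exp_pos _
  have hlow : ∀ N, 1 ≤ N → K N * c ≤ Za K Q μ0 f β h N := by
    intro N hN
    refine le_trans ?_ (le_pinSum_aux μ0 hμ0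
      (fun t x y => K t * (Q ^ t) x y * Real.exp (β * f y + h)) hW N hN)
    calc K N * c = ∑ x, ∑ y, μ0 x * (K N * (Q ^ N) x y * c) := by
          have : ∀ x y, μ0 x * (K N * (Q ^ N) x y * c) = (K N * c) * (μ0 x * (Q ^ N) x y) := by
            intro x y; ring
          simp_rw [this, ← Finset.mul_sum, pow_row_aux Q hQ1 N, mul_one, hμ1, mul_one]
      _ ≤ _ := Finset.sum_le_sum fun x _ => Finset.sum_le_sum fun y _ =>
          mul_le_mul_of_nonneg_left (mul_le_mul_of_nonneg_left (hz y)
            (mul_nonneg (hKpos N hN).le (hQn N x y))) (hμ0 x)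
  have hup : ∀ N, Za K Q μ0 f β h N ≤ N * C := hC
  have hCpos : 0 < C := by
    have h1 := (hlow 1 le_rfl).trans (hup 1)
    have h2 := mul_pos (hKpos 1 le_rfl) hcpos
    simp only [Nat.cast_one, one_mul] at h1
    linarith
  have hconst : ∀ a : ℝ, Tendsto (fun N : ℕ => a / (N : ℝ)) atTop (𝓝 0) :=
    fun a => tendsto_const_div_atTop_nhds_zero_nat a
  have hlog : Tendsto (fun N : ℕ => Real.log N / (N : ℝ)) atTop (𝓝 0) :=
    (Real.isLittleO_log_id_atTop.tendsto_div_nhds_zero).comp tendsto_natCast_atTop_atTop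
  have hL : Tendsto (fun N : ℕ => Real.log (K N) / N + Real.log c / N) atTop (𝓝 0) := by
    simpa using hK.add (hconst (Real.log c))
  have hU : Tendsto (fun N : ℕ => Real.log N / (N : ℝ) + Real.log C / N) atTop (𝓝 0) := by
    simpa using hlog.add (hconst (Real.log C))
  refine tendsto_of_tendsto_of_tendsto_of_le_of_le' hL hU ?_ ?_
  · filter_upwards [eventually_ge_atTop 1] with N hN
    rw [← add_div, ← Real.log_mul (hKpos N hN).ne' hcpos.ne']
    exact div_le_div_of_nonneg_right
      (Real.log_le_log (mul_pos (hKpos N hN) hcpos) (hlow N hN)) (Nat.cast_nonneg N)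
  · filter_upwards [eventually_ge_atTop 1] with N hN
    have hN0 : (N : ℝ) ≠ 0 := by positivity
    rw [← add_div, ← Real.log_mul hN0 hCpos.ne']
    exact div_le_div_of_nonneg_right (Real.log_le_log
      ((mul_pos (hKpos N hN) hcpos).trans_le (hlow N hN)) (hup N)) (Nat.cast_nonneg N)
end

section
/- For fixed β ≥ 0 and h ∈ ℝ, the map b ↦ λ(b,β,h) is continuous and strictly decreasing on [0,∞), and λ(b,β,h) → 0 as b → ∞. Consequently, if λ(0,β,h) > 1 then there is exactly one b > 0 with λ(b,β,h) = 1. -/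
open Filter Topology Matrix

/-- Comparison of positive eigenvalues. -/
theorem eig_compare {S : Type*} [Fintype S] [Nonempty S] (A B : Matrix S S ℝ) (c l m : ℝ)
    (ξ u : S → ℝ) (hA : ∀ x y, 0 ≤ A x y) (hAB : ∀ x y, A x y ≤ c * B x y)
    (hξ : ∀ x, 0 < ξ x) (hu : ∀ x, 0 < u x)
    (h1 : A *ᵥ ξ = l • ξ) (h2 : B *ᵥ u = m • u) : l ≤ c * m := by
  obtain ⟨x, hx⟩ := Finite.exists_max (fun x => ξ x / u x)
  have e1 : ∑ y, A x y * ξ y = l * ξ x := by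
    have := congrFun h1 x
    simpa [Matrix.mulVec, dotProduct] using this
  have e2 : ∑ y, B x y * u y = m * u x := by
    have := congrFun h2 x
    simpa [Matrix.mulVec, dotProduct] using this
  have hM : 0 < ξ x / u x := div_pos (hξ x) (hu x)
  have e3 : l * ξ x ≤ (c * m) * ξ x := by
    calc l * ξ x = ∑ y, A x y * ξ y := e1.symm
      _ ≤ ∑ y, (c * (ξ x / u x)) * (B x y * u y) := by
          apply Finset.sum_le_sum
          intro y _
          have h3 : ξ y ≤ ξ x / u x * u y := (div_le_iff₀ (hu y)).1 (hx y)
          calc A x y * ξ y ≤ A x y * (ξ x / u x * u y) :=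
                mul_le_mul_of_nonneg_left h3 (hA x y)
            _ ≤ (c * B x y) * (ξ x / u x * u y) :=
                mul_le_mul_of_nonneg_right (hAB x y) (mul_pos hM (hu y)).le
            _ = _ := by ring
      _ = (c * (ξ x / u x)) * (m * u x) := by rw [← Finset.mul_sum, e2]
      _ = (c * m) * ξ x := by
          have := (hu x).ne'
          field_simp
  exact le_of_mul_le_mul_right e3 (hξ x)

/-- For fixed `β ≥ 0` and `h`, the map `b ↦ λ(b,β,h)` is
continuous and strictly decreasing on `[0,∞)` and tends to `0` at `∞`;
consequently if `λ(0,β,h) > 1` there is exactly one `b > 0` with `λ(b,β,h) = 1`.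
Here `lam b` is the Perron–Frobenius eigenvalue of `A(b,β,h)`, characterized as
the eigenvalue admitting an entrywise positive right eigenvector. -/
theorem statement3 {S : Type*} [Fintype S] [DecidableEq S] [Nonempty S]
    (K : ℕ → ℝ) (hKpos : ∀ n, 1 ≤ n → 0 < K n) (hKsum : ∑' n : ℕ, K (n + 1) = 1)
    (Q : Matrix S S ℝ) (hQ0 : ∀ x y, 0 ≤ Q x y) (hQ1 : ∀ x, ∑ y, Q x y = 1)
    (hQirr : ∀ x y, ∃ t, 1 ≤ t ∧ 0 < (Q ^ t) x y)
    (f : S → ℝ) (β h : ℝ) (hβ : 0 ≤ β)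
    (hAsum : ∀ b : ℝ, 0 ≤ b → ∀ x y : S, Summable fun t : ℕ =>
      K (t + 1) * (Q ^ (t + 1)) x y * Real.exp (β * f y + h) * Real.exp (-b * (t + 1)))
    (lam : ℝ → ℝ)
    (hlam : ∀ b : ℝ, 0 ≤ b → ∃ ξ : S → ℝ, (∀ x, 0 < ξ x) ∧
      (Amat K Q f b β h) *ᵥ ξ = lam b • ξ) :
    ContinuousOn lam (Set.Ici 0) ∧ StrictAntiOn lam (Set.Ici 0) ∧
      Tendsto lam atTop (𝓝 0) ∧
      (1 < lam 0 → ∃! b : ℝ, 0 < b ∧ lam b = 1) := by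
  have hQn : ∀ n x y, 0 ≤ (Q ^ n) x y := by
    intro n
    induction n with
    | zero =>
      intro x y
      rw [pow_zero, Matrix.one_apply]
      split_ifs <;> norm_num
    | succ n ih =>
      intro x y
      rw [pow_succ, Matrix.mul_apply]
      exact Finset.sum_nonneg fun z _ => mul_nonneg (ih x z) (hQ0 z y)
  have hT0 : ∀ (b : ℝ) x y (t : ℕ), 0 ≤ K (t + 1) * (Q ^ (t + 1)) x y *
      Real.exp (β * f y + h) * Real.exp (-b * (t + 1)) := by
    intro b x y t
    have h1 := hKpos (t + 1) (by omega)
    have h2 := hQn (t + 1) x y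
    positivity
  have hApos : ∀ b, 0 ≤ b → ∀ x y, 0 < Amat K Q f b β h x y := by
    intro b hb x y
    obtain ⟨t, ht, hq⟩ := hQirr x y
    obtain ⟨t, rfl⟩ := Nat.exists_eq_add_of_le' ht
    refine (hAsum b hb x y).tsum_pos (hT0 b x y) t ?_
    have h1 := hKpos (t + 1) (by omega)
    positivity
  have hdecay : ∀ a b, 0 ≤ a → a ≤ b → ∀ x y,
      Amat K Q f b β h x y ≤ Real.exp (-(b - a)) * Amat K Q f a β h x y := by
    intro a b ha hab x y
    simp only [Amat, Matrix.of_apply]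
    rw [← tsum_mul_left]
    refine (hAsum b (ha.trans hab) x y).tsum_le_tsum (fun t => ?_)
      ((hAsum a ha x y).mul_left _)
    have h1 := hKpos (t + 1) (by omega)
    have h2 := hQn (t + 1) x y
    have h3 : Real.exp (-b * (t + 1)) ≤ Real.exp (-(b - a)) * Real.exp (-a * (t + 1)) := by
      rw [← Real.exp_add]
      apply Real.exp_le_exp.2
      nlinarith [mul_nonneg (sub_nonneg.2 hab) (Nat.cast_nonneg (α := ℝ) t)]
    calc _ ≤ K (t + 1) * (Q ^ (t + 1)) x y * Real.exp (β * f y + h) *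
          (Real.exp (-(b - a)) * Real.exp (-a * (t + 1))) :=
          mul_le_mul_of_nonneg_left h3 (by positivity)
      _ = _ := by ring
  have hcmp : ∀ a b c, 0 ≤ a → 0 ≤ b →
      (∀ x y, Amat K Q f b β h x y ≤ c * Amat K Q f a β h x y) → lam b ≤ c * lam a := by
    intro a b c ha hb hc
    obtain ⟨ξ, hξ, h1⟩ := hlam b hb
    obtain ⟨u, hu, h2⟩ := hlam a ha
    exact eig_compare _ _ c _ _ ξ u (fun x y => (hApos b hb x y).le) hc hξ hu h1 h2
  have hpos : ∀ b, 0 ≤ b → 0 < lam b := by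
    intro b hb
    obtain ⟨ξ, hξ, h1⟩ := hlam b hb
    obtain ⟨x⟩ := ‹Nonempty S›
    have e1 : ∑ y, Amat K Q f b β h x y * ξ y = lam b * ξ x := by
      have := congrFun h1 x
      simpa [Matrix.mulVec, dotProduct] using this
    have : 0 < lam b * ξ x := by
      rw [← e1]
      exact Finset.sum_pos (fun y _ => mul_pos (hApos b hb x y) (hξ y)) ⟨x, Finset.mem_univ x⟩
    exact pos_of_mul_pos_left this (hξ x).le
  have hanti : StrictAntiOn lam (Set.Ici 0) := by
    intro a ha b hb hab
    have h1 := hcmp a b _ ha hb (hdecay a b ha hab.le)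
    have h2 : Real.exp (-(b - a)) < 1 := by rw [← Real.exp_zero]; exact Real.exp_lt_exp.2 (by linarith)
    nlinarith [hpos a ha]
  have hlim : Tendsto lam atTop (𝓝 0) := by
    have hE : Tendsto (fun b : ℝ => Real.exp (-b) * lam 0) atTop (𝓝 0) := by
      simpa using Real.tendsto_exp_neg_atTop_nhds_zero.mul_const (lam 0)
    refine tendsto_of_tendsto_of_tendsto_of_le_of_le' tendsto_const_nhds hE ?_ ?_
    · filter_upwards [eventually_ge_atTop 0] with b hb using (hpos b hb).le
    · filter_upwards [eventually_ge_atTop 0] with b hb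
      simpa using hcmp 0 b _ le_rfl hb (hdecay 0 b le_rfl hb)
  have hAcont : ∀ x y, ContinuousOn (fun b => Amat K Q f b β h x y) (Set.Ici 0) := by
    intro x y
    simp only [Amat, Matrix.of_apply]
    refine continuousOn_tsum (fun t => ?_) (hAsum 0 le_rfl x y) (fun t b hb => ?_)
    · fun_prop
    · rw [Real.norm_of_nonneg (hT0 b x y t)]
      have h1 := hKpos (t + 1) (by omega)
      have h2 := hQn (t + 1) x y
      have hb' : (0 : ℝ) ≤ b := hb
      refine mul_le_mul_of_nonneg_left (Real.exp_le_exp.2 ?_) (by positivity)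
      have : 0 ≤ b * ((t : ℝ) + 1) := by positivity
      linarith
  have hcont : ContinuousOn lam (Set.Ici 0) := by
    intro a ha
    have hA : ∀ x y, Tendsto (fun b => Amat K Q f b β h x y) (𝓝[Set.Ici 0] a)
        (𝓝 (Amat K Q f a β h x y)) := fun x y => hAcont x y a ha
    have hr1 : ∀ x y, Tendsto (fun b => |Amat K Q f b β h x y / Amat K Q f a β h x y - 1|)
        (𝓝[Set.Ici 0] a) (𝓝 0) := by
      intro x y
      have h0 := (hApos a ha x y).ne'
      have := (((hA x y).div_const (Amat K Q f a β h x y)).sub_const 1).abs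
      rwa [div_self h0, sub_self, abs_zero] at this
    have hr2 : ∀ x y, Tendsto (fun b => |Amat K Q f a β h x y / Amat K Q f b β h x y - 1|)
        (𝓝[Set.Ici 0] a) (𝓝 0) := by
      intro x y
      have h0 := (hApos a ha x y).ne'
      have := (((tendsto_const_nhds (x := Amat K Q f a β h x y)).div (hA x y) h0).sub_const 1).abs
      rwa [div_self h0, sub_self, abs_zero] at this
    have hs : ∀ F : ℝ → S → S → ℝ, (∀ x y, Tendsto (fun b => |F b x y - 1|)
        (𝓝[Set.Ici 0] a) (𝓝 0)) → Tendsto (fun b => 1 + ∑ x, ∑ y, |F b x y - 1|)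
        (𝓝[Set.Ici 0] a) (𝓝 1) := by
      intro F hF
      have := (tendsto_finsetSum Finset.univ fun x _ =>
        tendsto_finsetSum Finset.univ fun y _ => hF x y).const_add 1
      simpa using this
    have hb : ∀ (F : S → S → ℝ) x y, F x y ≤ 1 + ∑ x, ∑ y, |F x y - 1| := by
      intro F x y
      have h1 : |F x y - 1| ≤ ∑ y, |F x y - 1| :=
        Finset.single_le_sum (f := fun y => |F x y - 1|) (fun _ _ => abs_nonneg _)
          (Finset.mem_univ y)
      have h2 : ∑ y, |F x y - 1| ≤ ∑ x, ∑ y, |F x y - 1| :=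
        Finset.single_le_sum (f := fun x => ∑ y, |F x y - 1|)
          (fun _ _ => Finset.sum_nonneg fun _ _ => abs_nonneg _) (Finset.mem_univ x)
      linarith [le_abs_self (F x y - 1)]
    have hc1 := hs (fun b x y => Amat K Q f b β h x y / Amat K Q f a β h x y) hr1
    have hc2 := hs (fun b x y => Amat K Q f a β h x y / Amat K Q f b β h x y) hr2
    have hU := hc1.mul_const (lam a)
    have hL := (tendsto_const_nhds (x := lam a)).div hc2 one_ne_zero
    rw [one_mul] at hU
    rw [div_one] at hL
    refine tendsto_of_tendsto_of_tendsto_of_le_of_le' hL hU ?_ ?_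
    · filter_upwards [self_mem_nhdsWithin] with b hb'
      have hp : 0 < 1 + ∑ x, ∑ y, |Amat K Q f a β h x y / Amat K Q f b β h x y - 1| := by
        positivity
      simp only [Pi.div_apply]
      rw [div_le_iff₀ hp, mul_comm]
      refine hcmp b a _ hb' ha fun x y => ?_
      rw [← div_le_iff₀ (hApos b hb' x y)]
      exact hb (fun x y => Amat K Q f a β h x y / Amat K Q f b β h x y) x y
    · filter_upwards [self_mem_nhdsWithin] with b hb'
      refine hcmp a b _ ha hb' fun x y => ?_
      rw [← div_le_iff₀ (hApos a ha x y)]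
      exact hb (fun x y => Amat K Q f b β h x y / Amat K Q f a β h x y) x y
  refine ⟨hcont, hanti, hlim, fun h1 => ?_⟩
  obtain ⟨B, hB1, hB0⟩ := ((hlim.eventually_lt_const one_pos).and (eventually_ge_atTop 0)).exists
  obtain ⟨b, hb, hb1⟩ := intermediate_value_Icc' hB0
    (hcont.mono Set.Icc_subset_Ici_self) ⟨hB1.le, h1.le⟩
  have hb0 : 0 < b := by
    rcases hb.1.eq_or_lt with h0 | h0
    · subst h0
      linarith
    · exact h0
  refine ⟨b, ⟨hb0, hb1⟩, ?_⟩
  rintro c ⟨hc0, hc1⟩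
  exact hanti.injOn hc0.le hb0.le (hc1.trans hb1.symm)
end

section
/- Assume λ(0,β,h) > 1, let F^a > 0 be the unique solution of λ(F^a,β,h) = 1, and let ξ : Σ → (0,∞) be a right Perron–Frobenius eigenvector of A(F^a,β,h). Define p(x,y,t) := M(t,β,h)(x,y) e^{−F^a t} ξ(y)/ξ(x). Then: (i) p is a semi-Markov kernel, i.e. Σ_{t≥1} Σ_{y∈Σ} p(x,y,t) = 1 for every x ∈ Σ; (ii) setting S_N := Σ_{k=1}^N Σ_{0=t_0<⋯<t_k=N} Σ_{x_0,…,x_k∈Σ} μ0(x_0) ∏_{i=1}^k p(x_{i−1},x_i,t_i−t_{i−1}), c := min_{x,y∈Σ} ξ(x)/ξ(y) and C := max_{x,y∈Σ} ξ(x)/ξ(y), one has c e^{F^a N} S_N ≤ Z^a_N(β,h) ≤ C e^{F^a N} S_N for every N ≥ 1. -/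
open Filter Topology Matrix

/-- The semi-Markov kernel `p(x,y,t) = M(t,β,h)(x,y) e^{-Fᵃ t} ξ(y)/ξ(x)`. -/
noncomputable def pker {S : Type*} [Fintype S] [DecidableEq S] (K : ℕ → ℝ)
    (Q : Matrix S S ℝ) (f : S → ℝ) (β h Fa : ℝ) (ξ : S → ℝ) (t : ℕ) (x y : S) : ℝ :=
  K t * (Q ^ t) x y * Real.exp (β * f y + h) * Real.exp (-Fa * t) * ξ y / ξ x

theorem pinSum_le_aux_s4 {S : Type*} [Fintype S] (μ0 : S → ℝ) (W V : ℕ → S → S → ℝ) (a b : ℝ)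
    (N : ℕ)
    (H : ∀ (k : ℕ) (s : Fin k → ℕ) (x : Fin (k + 1) → S), (∀ i, 1 ≤ s i) → (∑ i, s i) = N →
      a * (μ0 (x 0) * ∏ i : Fin k, W (s i) (x i.castSucc) (x i.succ)) ≤
      b * (μ0 (x 0) * ∏ i : Fin k, V (s i) (x i.castSucc) (x i.succ))) :
    a * pinSum μ0 W N ≤ b * pinSum μ0 V N := by
  unfold pinSum
  simp only [Finset.mul_sum]
  refine Finset.sum_le_sum fun k _ => Finset.sum_le_sum fun s _ => ?_
  split_ifs with hs
  · rw [Finset.mul_sum, Finset.mul_sum]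
    exact Finset.sum_le_sum fun x _ => H k (fun i => (s i : ℕ)) x hs.1 hs.2
  · simp

theorem prod_tilt_aux {S : Type*} (W : ℕ → S → S → ℝ) (Fa : ℝ) (ξ : S → ℝ)
    (hξ : ∀ x, 0 < ξ x) (k : ℕ) (s : Fin k → ℕ) (x : Fin (k + 1) → S) :
    ∏ i : Fin k, (W (s i) (x i.castSucc) (x i.succ) * Real.exp (-Fa * (s i : ℕ)) *
        ξ (x i.succ) / ξ (x i.castSucc)) =
      (∏ i : Fin k, W (s i) (x i.castSucc) (x i.succ)) *
        Real.exp (-Fa * ((∑ i, s i : ℕ) : ℝ)) * ξ (x (Fin.last k)) / ξ (x 0) := by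
  induction k with
  | zero =>
    have := (hξ (x 0)).ne'
    simp [this]
  | succ n ih =>
    rw [Fin.prod_univ_castSucc, Fin.prod_univ_castSucc, Fin.sum_univ_castSucc]
    have := ih (fun i => s i.castSucc) (fun i => x i.castSucc)
    simp only [← Fin.succ_castSucc] at this ⊢
    simp only [Fin.succ_castSucc] at this ⊢
    rw [this]
    have h1 := (hξ (x (Fin.last n).castSucc)).ne'
    have h0 := (hξ (x 0)).ne'
    rw [Nat.cast_add, mul_add, Real.exp_add]
    simp only [Fin.castSucc_zero, Fin.succ_last]
    field_simp

/-- With `λ(0,β,h) > 1`, `Fᵃ > 0` the solution of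
`λ(Fᵃ,β,h) = 1` and `ξ` a positive right Perron–Frobenius eigenvector of
`A(Fᵃ,β,h)` (of eigenvalue `1`): (i) `p` is a semi-Markov kernel; (ii) with
`S_N` the corresponding Markov renewal mass at `N`,
`c e^{Fᵃ N} S_N ≤ Z^a_N ≤ C e^{Fᵃ N} S_N` where `c` and `C` are the min and max
of the ratios `ξ(x)/ξ(y)`. -/
theorem statement4 {S : Type*} [Fintype S] [DecidableEq S] [Nonempty S]
    (K : ℕ → ℝ) (hKpos : ∀ n, 1 ≤ n → 0 < K n) (hKsum : ∑' n : ℕ, K (n + 1) = 1)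
    (Q : Matrix S S ℝ) (hQ0 : ∀ x y, 0 ≤ Q x y) (hQ1 : ∀ x, ∑ y, Q x y = 1)
    (hQirr : ∀ x y, ∃ t, 1 ≤ t ∧ 0 < (Q ^ t) x y)
    (μ0 : S → ℝ) (hμ0 : ∀ x, 0 ≤ μ0 x) (hμ1 : ∑ x, μ0 x = 1)
    (hμinv : ∀ y, ∑ x, μ0 x * Q x y = μ0 y)
    (f : S → ℝ) (β h : ℝ) (hβ : 0 ≤ β)
    (hAsum : ∀ b : ℝ, 0 ≤ b → ∀ x y : S, Summable fun t : ℕ =>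
      K (t + 1) * (Q ^ (t + 1)) x y * Real.exp (β * f y + h) * Real.exp (-b * (t + 1)))
    (lam : ℝ → ℝ)
    (hlam : ∀ b : ℝ, 0 ≤ b → ∃ ξ : S → ℝ, (∀ x, 0 < ξ x) ∧
      (Amat K Q f b β h) *ᵥ ξ = lam b • ξ)
    (hlam0 : 1 < lam 0)
    (Fa : ℝ) (hFa : 0 < Fa) (hlamFa : lam Fa = 1)
    (ξ : S → ℝ) (hξpos : ∀ x, 0 < ξ x)
    (hξeig : (Amat K Q f Fa β h) *ᵥ ξ = ξ) :
    (∀ x : S, ∑' t : ℕ, ∑ y : S, pker K Q f β h Fa ξ (t + 1) x y = 1) ∧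
    ∀ N : ℕ, 1 ≤ N →
      (⨅ x : S, ⨅ y : S, ξ x / ξ y) * Real.exp (Fa * N) *
          pinSum μ0 (pker K Q f β h Fa ξ) N ≤ Za K Q μ0 f β h N ∧
      Za K Q μ0 f β h N ≤ (⨆ x : S, ⨆ y : S, ξ x / ξ y) * Real.exp (Fa * N) *
          pinSum μ0 (pker K Q f β h Fa ξ) N := by
  have hQn : ∀ t x y, 0 ≤ (Q ^ t) x y := by
    intro t
    induction t with
    | zero =>
      intro x y
      rw [pow_zero, Matrix.one_apply]
      split_ifs <;> norm_num
    | succ n ih =>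
      intro x y
      rw [pow_succ, Matrix.mul_apply]
      exact Finset.sum_nonneg fun z _ => mul_nonneg (ih x z) (hQ0 z y)
  constructor
  · intro x
    have hx := congrFun hξeig x
    have hs := hAsum Fa hFa.le x
    have hterm : ∀ y, HasSum (fun t : ℕ => pker K Q f β h Fa ξ (t + 1) x y)
        (Amat K Q f Fa β h x y * ξ y / ξ x) := by
      intro y
      have := ((hs y).hasSum.mul_right (ξ y)).div_const (ξ x)
      simpa [pker, Amat] using this
    have := hasSum_sum (s := Finset.univ) fun y _ => hterm y
    rw [this.tsum_eq, ← Finset.sum_div]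
    have h2 : ∑ y, Amat K Q f Fa β h x y * ξ y = ξ x := by
      simpa [Matrix.mulVec, dotProduct] using hx
    rw [h2, div_self (hξpos x).ne']
  · intro N hN
    have hlow : ∀ x y, (⨅ x : S, ⨅ y : S, ξ x / ξ y) ≤ ξ x / ξ y := fun x y =>
      (ciInf_le (Set.finite_range _).bddBelow x).trans
        (ciInf_le (Set.finite_range _).bddBelow y)
    have hup : ∀ x y, ξ x / ξ y ≤ (⨆ x : S, ⨆ y : S, ξ x / ξ y) := fun x y =>
      (le_ciSup (f := fun y => ξ x / ξ y) (Set.finite_range _).bddAbove y).trans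
        (le_ciSup (f := fun x => ⨆ y : S, ξ x / ξ y) (Set.finite_range _).bddAbove x)
    generalize (⨅ x : S, ⨅ y : S, ξ x / ξ y) = c at hlow
    generalize (⨆ x : S, ⨆ y : S, ξ x / ξ y) = C at hup
    set W : ℕ → S → S → ℝ := fun t x y => K t * (Q ^ t) x y * Real.exp (β * f y + h) with hW
    have hZ : Za K Q μ0 f β h N = 1 * pinSum μ0 W N := by rw [one_mul]; rfl
    have hnn : ∀ (k : ℕ) (s : Fin k → ℕ) (x : Fin (k + 1) → S), (∀ i, 1 ≤ s i) →
        0 ≤ μ0 (x 0) * ∏ i : Fin k, W (s i) (x i.castSucc) (x i.succ) := by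
      intro k s x hs
      refine mul_nonneg (hμ0 _) (Finset.prod_nonneg fun i _ => ?_)
      exact mul_nonneg (mul_nonneg (hKpos _ (hs i)).le (hQn _ _ _)) (Real.exp_pos _).le
    have hkey : ∀ (d : ℝ) (k : ℕ) (s : Fin k → ℕ) (x : Fin (k + 1) → S), (∑ i, s i) = N →
        d * Real.exp (Fa * N) * (μ0 (x 0) * ∏ i : Fin k,
          pker K Q f β h Fa ξ (s i) (x i.castSucc) (x i.succ)) =
        (d * (ξ (x (Fin.last k)) / ξ (x 0))) *
          (μ0 (x 0) * ∏ i : Fin k, W (s i) (x i.castSucc) (x i.succ)) := by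
      intro d k s x hs
      have h1 := prod_tilt_aux W Fa ξ hξpos k s x
      rw [hs] at h1
      have h2 : ∏ i : Fin k, pker K Q f β h Fa ξ (s i) (x i.castSucc) (x i.succ) = _ := h1
      rw [h2, neg_mul, Real.exp_neg]
      have h0 := (hξpos (x 0)).ne'
      have he := (Real.exp_pos (Fa * N)).ne'
      field_simp
    rw [hZ]
    constructor
    · refine pinSum_le_aux_s4 μ0 _ _ _ _ N fun k s x hs hsum => ?_
      rw [hkey _ k s x hsum]
      refine mul_le_mul_of_nonneg_right ?_ (hnn k s x hs)
      have h0 := hξpos (x 0)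
      have hl := hξpos (x (Fin.last k))
      calc c * (ξ (x (Fin.last k)) / ξ (x 0))
          ≤ (ξ (x 0) / ξ (x (Fin.last k))) * (ξ (x (Fin.last k)) / ξ (x 0)) :=
            mul_le_mul_of_nonneg_right (hlow _ _) (by positivity)
        _ = 1 := by field_simp
    · refine pinSum_le_aux_s4 μ0 _ _ _ _ N fun k s x hs hsum => ?_
      rw [hkey _ k s x hsum]
      refine mul_le_mul_of_nonneg_right ?_ (hnn k s x hs)
      have h0 := hξpos (x 0)
      have hl := hξpos (x (Fin.last k))
      calc 1 = (ξ (x 0) / ξ (x (Fin.last k))) * (ξ (x (Fin.last k)) / ξ (x 0)) := by field_simp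
        _ ≤ C * (ξ (x (Fin.last k)) / ξ (x 0)) :=
            mul_le_mul_of_nonneg_right (hup _ _) (by positivity)
end

section
/- Assume λ(0,β,h) > 1, let F^a > 0 be the unique solution of λ(F^a,β,h) = 1, let ξ : Σ → (0,∞) be a right Perron–Frobenius eigenvector of A(F^a,β,h), and set p(x,y,t) := M(t,β,h)(x,y) e^{−F^a t} ξ(y)/ξ(x) and S_N := Σ_{k=1}^N Σ_{0=t_0<⋯<t_k=N} Σ_{x_0,…,x_k∈Σ} μ0(x_0) ∏_{i=1}^k p(x_{i−1},x_i,t_i−t_{i−1}) (the probability that N is a point of the associated Markov renewal process). Then liminf_{N→∞} S_N > 0. -/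
open Filter Topology Matrix

/-- Mass of `k` jumps ending at time `n` in state `y`. -/
noncomputable def vk {S : Type*} [Fintype S] (μ0 : S → ℝ) (W : ℕ → S → S → ℝ) :
    ℕ → ℕ → S → ℝ
  | 0, n, y => if n = 0 then μ0 y else 0
  | k + 1, n, y => ∑ s ∈ Finset.range n, ∑ x, vk μ0 W k s x * W (n - s) x y

/-- Renewal mass at time `n` in state `y`. -/
noncomputable def vv {S : Type*} [Fintype S] (μ0 : S → ℝ) (W : ℕ → S → S → ℝ)
    (n : ℕ) (y : S) : ℝ := ∑ k ∈ Finset.range (n + 1), vk μ0 W k n y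

lemma sum_reindex_aux (B n : ℕ) (hn : n ≤ B) (F : ℕ → ℕ → ℝ) :
    ∑ a : Fin (B + 1), (if 1 ≤ (a : ℕ) ∧ (a : ℕ) ≤ n then F (n - a) a else 0)
      = ∑ s ∈ Finset.range n, F s (n - s) := by
  rw [Fin.sum_univ_eq_sum_range (fun a => if 1 ≤ a ∧ a ≤ n then F (n - a) a else 0) (B + 1),
    ← Finset.sum_filter]
  refine Finset.sum_nbij' (fun a => n - a) (fun s => n - s) ?_ ?_ ?_ ?_ ?_
  · intro a ha
    simp only [Finset.mem_filter, Finset.mem_range] at ha ⊢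
    omega
  · intro a ha
    simp only [Finset.mem_filter, Finset.mem_range] at ha ⊢
    omega
  · intro a ha
    simp only [Finset.mem_filter, Finset.mem_range] at ha ⊢
    omega
  · intro a ha
    simp only [Finset.mem_range] at ha ⊢
    omega
  · intro a ha
    simp only [Finset.mem_filter, Finset.mem_range] at ha
    have : n - (n - a) = a := by omega
    simp only [this]

lemma sum_snoc_aux {α : Type*} [Fintype α] (k : ℕ) (F : (Fin (k + 1) → α) → ℝ) :
    ∑ s : Fin (k + 1) → α, F s
      = ∑ a : α, ∑ s : Fin k → α, F (Fin.snoc (α := fun _ => α) s a) := by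
  rw [← Fintype.sum_prod_type']
  exact (Fintype.sum_equiv (Fin.snocEquiv (fun _ : Fin (k + 1) => α)) _ _ (fun _ => rfl)).symm

lemma pin_aux {S : Type*} [Fintype S] (μ0 : S → ℝ) (W : ℕ → S → S → ℝ) (B : ℕ) (k : ℕ) :
    ∀ n, n ≤ B → ∀ φ : S → ℝ,
    ∑ s : Fin k → Fin (B + 1), (if (∀ i, 1 ≤ (s i : ℕ)) ∧ (∑ i, (s i : ℕ)) = n then
      ∑ x : Fin (k + 1) → S, μ0 (x 0) * (∏ i : Fin k, W (s i : ℕ) (x i.castSucc) (x i.succ))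
        * φ (x (Fin.last k))
    else 0) = ∑ y, vk μ0 W k n y * φ y := by
  induction k with
  | zero =>
    intro n hn φ
    have h1 : ∀ G : (Fin (0 + 1) → S) → ℝ, ∑ x, G x = ∑ y, G (fun _ => y) := by
      intro G
      refine Fintype.sum_equiv (Equiv.funUnique (Fin 1) S) _ _ (fun x => ?_)
      congr 1
      funext i
      have hi : i = (default : Fin 1) := Subsingleton.elim (α := Fin 1) i default
      rw [hi]
      rfl
    by_cases h0 : n = 0
    · subst h0
      simp [h1, vk]
    · simp [vk, h0, Ne.symm h0]
  | succ k ih =>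
    intro n hn φ
    rw [sum_snoc_aux]
    have key : ∀ a : Fin (B + 1), ∑ s : Fin k → Fin (B + 1),
        (if (∀ i, 1 ≤ ((Fin.snoc (α := fun _ => Fin (B + 1)) s a : Fin (k + 1) → Fin (B + 1)) i : ℕ)) ∧
          (∑ i, ((Fin.snoc (α := fun _ => Fin (B + 1)) s a : Fin (k + 1) → Fin (B + 1)) i : ℕ)) = n then
          ∑ x : Fin (k + 1 + 1) → S, μ0 (x 0) * (∏ i : Fin (k + 1),
            W ((Fin.snoc (α := fun _ => Fin (B + 1)) s a : Fin (k + 1) → Fin (B + 1)) i : ℕ)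
              (x i.castSucc) (x i.succ)) * φ (x (Fin.last (k + 1)))
        else 0) = if 1 ≤ (a : ℕ) ∧ (a : ℕ) ≤ n then
          ∑ y, vk μ0 W k (n - a) y * ∑ z, W a y z * φ z else 0 := by
      intro a
      by_cases ha : 1 ≤ (a : ℕ) ∧ (a : ℕ) ≤ n
      · rw [if_pos ha, ← ih (n - a) (by omega)]
        refine Finset.sum_congr rfl fun s _ => ?_
        have hc : ((∀ i, 1 ≤ ((Fin.snoc (α := fun _ => Fin (B + 1)) s a : Fin (k + 1) → Fin (B + 1)) i : ℕ)) ∧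
          (∑ i, ((Fin.snoc (α := fun _ => Fin (B + 1)) s a : Fin (k + 1) → Fin (B + 1)) i : ℕ)) = n) ↔
          ((∀ i, 1 ≤ (s i : ℕ)) ∧ (∑ i, (s i : ℕ)) = n - a) := by
          rw [Fin.forall_fin_succ', Fin.sum_univ_castSucc]
          simp only [Fin.snoc_castSucc, Fin.snoc_last]
          constructor
          · rintro ⟨⟨h1, h2⟩, h3⟩
            exact ⟨h1, by omega⟩
          · rintro ⟨h1, h3⟩
            exact ⟨⟨h1, ha.1⟩, by omega⟩
        refine if_congr hc ?_ rfl
        rw [sum_snoc_aux, Finset.sum_comm]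
        refine Finset.sum_congr rfl fun x _ => ?_
        rw [Finset.mul_sum]
        refine Finset.sum_congr rfl fun z _ => ?_
        rw [Fin.prod_univ_castSucc]
        simp only [Fin.snoc_castSucc, Fin.snoc_last, Fin.succ_last]
        have e0 : (Fin.snoc (α := fun _ => S) x z : Fin (k + 1 + 1) → S) 0 = x 0 := by
          rw [← Fin.castSucc_zero, Fin.snoc_castSucc]
        have e1 : ∀ i : Fin k, (Fin.snoc (α := fun _ => S) x z : Fin (k + 1 + 1) → S)
            i.castSucc.succ = x i.succ := by
          intro i
          rw [Fin.succ_castSucc, Fin.snoc_castSucc]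
        simp only [e0, e1]
        ring
      · rw [if_neg ha]
        refine Finset.sum_eq_zero fun s _ => if_neg ?_
        rw [Fin.forall_fin_succ', Fin.sum_univ_castSucc]
        simp only [Fin.snoc_castSucc, Fin.snoc_last]
        rintro ⟨⟨h1, h2⟩, h3⟩
        exact ha ⟨h2, by omega⟩
    rw [Finset.sum_congr rfl fun a _ => key a]
    rw [sum_reindex_aux B n hn (fun s a => ∑ y, vk μ0 W k s y * ∑ z, W a y z * φ z)]
    simp only [vk, Finset.sum_mul, Finset.mul_sum]
    rw [Finset.sum_comm (s := Finset.univ) (t := Finset.range n)]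
    refine Finset.sum_congr rfl fun s _ => ?_
    rw [Finset.sum_comm]
    refine Finset.sum_congr rfl fun y _ => Finset.sum_congr rfl fun x _ => ?_
    ring

lemma vk_eq_zero {S : Type*} [Fintype S] (μ0 : S → ℝ) (W : ℕ → S → S → ℝ) (k : ℕ) :
    ∀ n, n < k → ∀ y, vk μ0 W k n y = 0 := by
  induction k with
  | zero => intro n hn; omega
  | succ k ih =>
    intro n hn y
    simp only [vk]
    refine Finset.sum_eq_zero fun s hs => Finset.sum_eq_zero fun x _ => ?_
    rw [ih s (by have := Finset.mem_range.1 hs; omega), zero_mul]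

lemma vv_eq {S : Type*} [Fintype S] (μ0 : S → ℝ) (W : ℕ → S → S → ℝ) (n M : ℕ) (h : n + 1 ≤ M)
    (y : S) : ∑ k ∈ Finset.range M, vk μ0 W k n y = vv μ0 W n y := by
  unfold vv
  symm
  apply Finset.sum_subset (Finset.range_mono h)
  intro k _ hk
  exact vk_eq_zero μ0 W k n (by simp at hk; omega) y

lemma vv_zero {S : Type*} [Fintype S] (μ0 : S → ℝ) (W : ℕ → S → S → ℝ) (y : S) :
    vv μ0 W 0 y = μ0 y := by simp [vv, vk]

lemma vv_succ {S : Type*} [Fintype S] (μ0 : S → ℝ) (W : ℕ → S → S → ℝ) (n : ℕ) (y : S) :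
    vv μ0 W (n + 1) y
      = ∑ s ∈ Finset.range (n + 1), ∑ x, vv μ0 W s x * W (n + 1 - s) x y := by
  rw [vv, Finset.sum_range_succ']
  simp only [vk, Nat.add_eq_zero_iff, one_ne_zero, and_false, if_false, add_zero]
  rw [Finset.sum_comm]
  refine Finset.sum_congr rfl fun s hs => ?_
  rw [Finset.sum_comm]
  refine Finset.sum_congr rfl fun x _ => ?_
  rw [← Finset.sum_mul, vv_eq]
  have := Finset.mem_range.1 hs
  omega

lemma pinSum_eq_s5 {S : Type*} [Fintype S] (μ0 : S → ℝ) (W : ℕ → S → S → ℝ) (n : ℕ) :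
    pinSum μ0 W (n + 1) = ∑ y, vv μ0 W (n + 1) y := by
  unfold pinSum
  have h : ∀ k, ∑ s : Fin k → Fin (n + 1 + 1),
      (if (∀ i, 1 ≤ (s i : ℕ)) ∧ (∑ i, (s i : ℕ)) = n + 1 then
      ∑ x : Fin (k + 1) → S, μ0 (x 0) * ∏ i : Fin k, W (s i : ℕ) (x i.castSucc) (x i.succ)
      else 0) = ∑ y, vk μ0 W k (n + 1) y := by
    intro k
    have := pin_aux μ0 W (n + 1) k (n + 1) le_rfl (fun _ => 1)
    simpa only [mul_one] using this
  rw [Finset.sum_congr rfl fun k _ => h k, Finset.sum_comm]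
  refine Finset.sum_congr rfl fun y _ => ?_
  unfold vv
  apply Finset.sum_subset
  · intro k hk
    simp at hk ⊢
    omega
  · intro k hk hk'
    have : k = 0 := by simp at hk hk'; omega
    subst this
    simp [vk]

lemma main_abstract {S : Type*} [Fintype S] [Nonempty S] (μ0 : S → ℝ) (hμ0 : ∀ x, 0 ≤ μ0 x)
    (hμ1 : ∑ x, μ0 x = 1) (W : ℕ → S → S → ℝ) (hW : ∀ t x y, 0 ≤ W (t + 1) x y)
    (hpos : ∀ t x, 0 < ∑ y, W (t + 1) x y)
    (hsum : ∀ x, HasSum (fun t => ∑ y, W (t + 1) x y) 1)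
    (C r : ℝ) (hr0 : 0 ≤ r) (hr1 : r < 1)
    (hb : ∀ t x, ∑ y, W (t + 1) x y ≤ C * r ^ t) :
    0 < Filter.liminf (fun N : ℕ => pinSum μ0 W N) atTop := by
  set V := vv μ0 W with hV
  set g : S → ℕ → ℝ := fun x t => ∑ y, W (t + 1) x y with hg
  set T : S → ℕ → ℝ := fun x m => 1 - ∑ i ∈ Finset.range m, g x i with hT
  have hVnn : ∀ n y, 0 ≤ V n y := by
    intro n
    induction n using Nat.strong_induction_on with
    | _ n ih =>
      intro y
      cases n with
      | zero => rw [hV, vv_zero]; exact hμ0 y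
      | succ n =>
        rw [hV, vv_succ]
        refine Finset.sum_nonneg fun s hs => Finset.sum_nonneg fun x _ => ?_
        have hs' := Finset.mem_range.1 hs
        have e : n + 1 - s = (n - s) + 1 := by omega
        rw [e]
        exact mul_nonneg (ih s hs' x) (hW _ _ _)
  have hVs : ∀ n, ∑ y, V (n + 1) y = ∑ s ∈ Finset.range (n + 1), ∑ x, V s x * g x (n - s) := by
    intro n
    simp only [hV, vv_succ]
    rw [Finset.sum_comm]
    refine Finset.sum_congr rfl fun s hs => ?_
    rw [Finset.sum_comm]
    refine Finset.sum_congr rfl fun x _ => ?_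
    have hs' := Finset.mem_range.1 hs
    have e : n + 1 - s = (n - s) + 1 := by omega
    rw [e, ← Finset.mul_sum]
  have hcons : ∀ n, ∑ s ∈ Finset.range (n + 1), ∑ x, V s x * T x (n - s) = 1 := by
    intro n
    induction n with
    | zero => simp [hT, hV, vv_zero, hμ1]
    | succ n ih =>
      rw [Finset.sum_range_succ]
      have h1 : ∑ s ∈ Finset.range (n + 1), ∑ x, V s x * T x (n + 1 - s)
          = ∑ s ∈ Finset.range (n + 1), ∑ x, V s x * T x (n - s)
            - ∑ s ∈ Finset.range (n + 1), ∑ x, V s x * g x (n - s) := by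
        rw [← Finset.sum_sub_distrib]
        refine Finset.sum_congr rfl fun s hs => ?_
        rw [← Finset.sum_sub_distrib]
        refine Finset.sum_congr rfl fun x _ => ?_
        have hs' := Finset.mem_range.1 hs
        have e : n + 1 - s = (n - s) + 1 := by omega
        rw [e]
        simp only [hT]
        rw [Finset.sum_range_succ]
        ring
      rw [h1, ih, ← hVs]
      simp [hT]
  have hgnn : ∀ x t, 0 ≤ g x t := fun x t => (hpos t x).le
  have hTnn : ∀ x m, 0 ≤ T x m := by
    intro x m
    have := sum_le_hasSum (Finset.range m) (fun i _ => hgnn x i) (hsum x)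
    simp only [hT]
    linarith
  have hT1 : ∀ x m, T x m ≤ 1 := by
    intro x m
    have := Finset.sum_nonneg (s := Finset.range m) (fun i _ => hgnn x i)
    simp only [hT]
    linarith
  have hTb : ∀ x m, T x m ≤ C * r ^ m * (1 - r)⁻¹ := by
    intro x m
    have h1 := (hsum x).summable.sum_add_tsum_nat_add m
    rw [(hsum x).tsum_eq] at h1
    have h2 : T x m = ∑' i, g x (i + m) := by
      simp only [hT]
      linarith
    have hgeo := (hasSum_geometric_of_lt_one hr0 hr1).mul_left (C * r ^ m)
    rw [h2]
    refine hasSum_le (fun i => ?_) ((summable_nat_add_iff m).2 (hsum x).summable).hasSum hgeo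
    calc g x (i + m) ≤ C * r ^ (i + m) := hb _ _
      _ = C * r ^ m * r ^ i := by ring
  have hVle : ∀ n, ∑ y, V n y ≤ 1 := by
    intro n
    have h := hcons n
    rw [Finset.sum_range_succ] at h
    have h0 : 0 ≤ ∑ s ∈ Finset.range n, ∑ x, V s x * T x (n - s) :=
      Finset.sum_nonneg fun s _ => Finset.sum_nonneg fun x _ => mul_nonneg (hVnn _ _) (hTnn _ _)
    have h2 : ∑ x, V n x * T x (n - n) = ∑ x, V n x := by simp [hT]
    linarith
  set B : ℕ → ℝ := fun m => C * r ^ m * (1 - r)⁻¹ with hB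
  have hBs : Summable B :=
    ((summable_geometric_of_lt_one hr0 hr1).mul_left C).mul_right _
  have hBnn : ∀ m, 0 ≤ B m := fun m =>
    (hTnn (Classical.arbitrary S) m).trans (hTb _ m)
  obtain ⟨L, hL⟩ := ((hBs.hasSum.tendsto_sum_nat).eventually
    (lt_mem_nhds (show (∑' m, B m) - 1 / 2 < ∑' m, B m by linarith))).exists
  -- lower bound on the gap law for short gaps
  obtain ⟨c, hc0, hc⟩ : ∃ c : ℝ, 0 < c ∧ ∀ t ∈ Finset.range (L + 1), ∀ x, c ≤ g x t := by
    have hne : (Finset.range (L + 1) ×ˢ (Finset.univ : Finset S)).Nonempty :=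
      ⟨(0, Classical.arbitrary S), by simp⟩
    obtain ⟨p, hp, hmin⟩ := Finset.exists_min_image _ (fun q : ℕ × S => g q.2 q.1) hne
    exact ⟨g p.2 p.1, hpos _ _, fun t ht x => hmin (t, x) (by simpa using ht)⟩
  have hlow : ∀ n, c / 2 ≤ ∑ y, V (n + 1) y := by
    intro n
    rw [hVs]
    have hpt : ∀ s ∈ Finset.range (n + 1),
        c * (∑ x, V s x * T x (n - s)) - c * (if L ≤ n - s then B (n - s) else 0)
          ≤ ∑ x, V s x * g x (n - s) := by
      intro s hs
      by_cases hLs : L ≤ n - s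
      · rw [if_pos hLs]
        have h1 : ∑ x, V s x * T x (n - s) ≤ B (n - s) := by
          calc ∑ x, V s x * T x (n - s) ≤ ∑ x, V s x * B (n - s) :=
                Finset.sum_le_sum fun x _ => mul_le_mul_of_nonneg_left (hTb x _) (hVnn _ _)
            _ = (∑ x, V s x) * B (n - s) := by rw [Finset.sum_mul]
            _ ≤ 1 * B (n - s) := mul_le_mul_of_nonneg_right (hVle s) (hBnn _)
            _ = _ := one_mul _
        have h2 : 0 ≤ ∑ x, V s x * g x (n - s) :=
          Finset.sum_nonneg fun x _ => mul_nonneg (hVnn _ _) (hgnn _ _)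
        have h3 := mul_le_mul_of_nonneg_left h1 hc0.le
        linarith
      · rw [if_neg hLs, mul_zero, sub_zero, Finset.mul_sum]
        refine Finset.sum_le_sum fun x _ => ?_
        have h1 := hc (n - s) (by simp; omega) x
        have h2 : V s x * T x (n - s) ≤ V s x := mul_le_of_le_one_right (hVnn _ _) (hT1 _ _)
        calc c * (V s x * T x (n - s)) ≤ c * V s x := mul_le_mul_of_nonneg_left h2 hc0.le
          _ = V s x * c := mul_comm _ _
          _ ≤ _ := mul_le_mul_of_nonneg_left h1 (hVnn _ _)
    have hBsum : ∑ s ∈ Finset.range (n + 1), (if L ≤ n - s then B (n - s) else 0) ≤ 1 / 2 := by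
      have e := Finset.sum_range_reflect (fun m => if L ≤ m then B m else 0) (n + 1)
      simp only [Nat.add_sub_cancel] at e
      rw [e, ← Finset.sum_filter]
      have hdisj : Disjoint ((Finset.range (n + 1)).filter (fun m => L ≤ m)) (Finset.range L) := by
        rw [Finset.disjoint_left]
        intro a ha hb
        simp at ha hb
        omega
      have h1 := hBs.sum_le_tsum
        (((Finset.range (n + 1)).filter (fun m => L ≤ m)) ∪ Finset.range L) (fun m _ => hBnn m)
      rw [Finset.sum_union hdisj] at h1
      linarith
    have h4 := Finset.sum_le_sum hpt
    rw [Finset.sum_sub_distrib, ← Finset.mul_sum, ← Finset.mul_sum, hcons] at h4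
    have h5 := mul_le_mul_of_nonneg_left hBsum hc0.le
    linarith
  have hev : ∀ᶠ N in atTop, c / 2 ≤ pinSum μ0 W N := by
    filter_upwards [eventually_ge_atTop 1] with N hN
    obtain ⟨n, rfl⟩ : ∃ n, N = n + 1 := ⟨N - 1, by omega⟩
    rw [pinSum_eq_s5]
    exact hlow n
  have hev2 : ∀ᶠ N in atTop, pinSum μ0 W N ≤ 1 := by
    filter_upwards [eventually_ge_atTop 1] with N hN
    obtain ⟨n, rfl⟩ : ∃ n, N = n + 1 := ⟨N - 1, by omega⟩
    rw [pinSum_eq_s5]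
    exact hVle _
  have hco : IsCoboundedUnder (· ≥ ·) atTop (fun N : ℕ => pinSum μ0 W N) :=
    (isBoundedUnder_of_eventually_le hev2).isCoboundedUnder_ge
  exact lt_of_lt_of_le (by linarith) (le_liminf_of_le hco hev)

/-- With `λ(0,β,h) > 1`, `Fᵃ > 0` the solution of
`λ(Fᵃ,β,h) = 1`, `ξ` a positive right Perron–Frobenius eigenvector of
`A(Fᵃ,β,h)` and `S_N` the mass the associated Markov renewal process gives to
`{N is a renewal point}`, one has `liminf S_N > 0`. -/
theorem statement5 {S : Type*} [Fintype S] [DecidableEq S] [Nonempty S]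
    (K : ℕ → ℝ) (hKpos : ∀ n, 1 ≤ n → 0 < K n) (hKsum : ∑' n : ℕ, K (n + 1) = 1)
    (Q : Matrix S S ℝ) (hQ0 : ∀ x y, 0 ≤ Q x y) (hQ1 : ∀ x, ∑ y, Q x y = 1)
    (hQirr : ∀ x y, ∃ t, 1 ≤ t ∧ 0 < (Q ^ t) x y)
    (μ0 : S → ℝ) (hμ0 : ∀ x, 0 ≤ μ0 x) (hμ1 : ∑ x, μ0 x = 1)
    (hμinv : ∀ y, ∑ x, μ0 x * Q x y = μ0 y)
    (f : S → ℝ) (β h : ℝ) (hβ : 0 ≤ β)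
    (hAsum : ∀ b : ℝ, 0 ≤ b → ∀ x y : S, Summable fun t : ℕ =>
      K (t + 1) * (Q ^ (t + 1)) x y * Real.exp (β * f y + h) * Real.exp (-b * (t + 1)))
    (lam : ℝ → ℝ)
    (hlam : ∀ b : ℝ, 0 ≤ b → ∃ ξ : S → ℝ, (∀ x, 0 < ξ x) ∧
      (Amat K Q f b β h) *ᵥ ξ = lam b • ξ)
    (hlam0 : 1 < lam 0)
    (Fa : ℝ) (hFa : 0 < Fa) (hlamFa : lam Fa = 1)
    (ξ : S → ℝ) (hξpos : ∀ x, 0 < ξ x)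
    (hξeig : (Amat K Q f Fa β h) *ᵥ ξ = ξ) :
    0 < Filter.liminf (fun N : ℕ => pinSum μ0 (pker K Q f β h Fa ξ) N) atTop := by
  have hKs : Summable fun n : ℕ => K (n + 1) := by
    by_contra hn
    rw [tsum_eq_zero_of_not_summable hn] at hKsum
    exact zero_ne_one hKsum
  have hK1 : ∀ n, K (n + 1) ≤ 1 := by
    intro n
    rw [← hKsum]
    exact hKs.le_tsum n (fun j _ => (hKpos _ (by omega)).le)
  have hQn : ∀ t x y, 0 ≤ (Q ^ t) x y := by
    intro t
    induction t with
    | zero =>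
      intro x y
      rw [pow_zero, Matrix.one_apply]
      split_ifs <;> norm_num
    | succ t ih =>
      intro x y
      rw [pow_succ, Matrix.mul_apply]
      exact Finset.sum_nonneg fun z _ => mul_nonneg (ih _ _) (hQ0 _ _)
  have hQs : ∀ t x, ∑ y, (Q ^ t) x y = 1 := by
    intro t
    induction t with
    | zero => intro x; simp [Matrix.one_apply]
    | succ t ih =>
      intro x
      simp only [pow_succ, Matrix.mul_apply]
      rw [Finset.sum_comm]
      simp only [← Finset.mul_sum, hQ1, mul_one, ih]
  have hQ1' : ∀ t x y, (Q ^ t) x y ≤ 1 := by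
    intro t x y
    rw [← hQs t x]
    exact Finset.single_le_sum (f := fun y => (Q ^ t) x y) (fun z _ => hQn t x z)
      (Finset.mem_univ y)
  have hW : ∀ t x y, 0 ≤ pker K Q f β h Fa ξ (t + 1) x y := by
    intro t x y
    have h1 := (hKpos (t + 1) (by omega)).le
    have h2 := hQn (t + 1) x y
    have h3 := (hξpos x).le
    have h4 := (hξpos y).le
    unfold pker
    positivity
  refine main_abstract μ0 hμ0 hμ1 _ hW ?_ ?_
    (∑ x, ∑ y, Real.exp (β * f y + h) * ξ y / ξ x) (Real.exp (-Fa)) (Real.exp_pos _).le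
    (by rw [Real.exp_lt_one_iff]; linarith) ?_
  · intro t x
    obtain ⟨y, hy⟩ : ∃ y, 0 < (Q ^ (t + 1)) x y := by
      by_contra hcon
      push Not at hcon
      have := Finset.sum_nonpos (s := Finset.univ) (fun y _ => hcon y)
      rw [hQs] at this
      linarith
    refine Finset.sum_pos' (fun y _ => hW t x y) ⟨y, Finset.mem_univ y, ?_⟩
    have h1 := hKpos (t + 1) (by omega)
    have h3 := hξpos x
    have h4 := hξpos y
    unfold pker
    positivity
  · intro x
    have hx := congrFun hξeig x
    simp only [Matrix.mulVec, dotProduct, Amat, Matrix.of_apply] at hx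
    have h1 : HasSum (fun t : ℕ => ∑ y, K (t + 1) * (Q ^ (t + 1)) x y * Real.exp (β * f y + h)
        * Real.exp (-Fa * (t + 1)) * ξ y) (ξ x) := by
      rw [← hx]
      exact hasSum_sum fun y _ => (hAsum Fa hFa.le x y).hasSum.mul_right (ξ y)
    have h2 := h1.div_const (ξ x)
    rw [div_self (hξpos x).ne'] at h2
    simp only [Finset.sum_div] at h2
    simpa [pker] using h2
  · intro t x
    have hexp : Real.exp (-Fa * ((t + 1 : ℕ) : ℝ)) ≤ Real.exp (-Fa) ^ t := by
      rw [← Real.exp_nat_mul]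
      apply Real.exp_le_exp.2
      push_cast
      linarith
    have hnn : ∀ x y, 0 ≤ Real.exp (β * f y + h) * ξ y / ξ x := by
      intro x y
      have h3 := (hξpos x).le
      have h4 := (hξpos y).le
      positivity
    have hpt : ∀ y, pker K Q f β h Fa ξ (t + 1) x y
        ≤ Real.exp (β * f y + h) * ξ y / ξ x * Real.exp (-Fa) ^ t := by
      intro y
      have e : pker K Q f β h Fa ξ (t + 1) x y
        = (K (t + 1) * (Q ^ (t + 1)) x y) * (Real.exp (β * f y + h) * ξ y / ξ x
            * Real.exp (-Fa * ((t + 1 : ℕ) : ℝ))) := by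
        unfold pker
        ring
      rw [e]
      have hKQ : K (t + 1) * (Q ^ (t + 1)) x y ≤ 1 :=
        mul_le_one₀ (hK1 t) (hQn _ _ _) (hQ1' _ _ _)
      calc _ ≤ 1 * (Real.exp (β * f y + h) * ξ y / ξ x
            * Real.exp (-Fa * ((t + 1 : ℕ) : ℝ))) :=
            mul_le_mul_of_nonneg_right hKQ (mul_nonneg (hnn x y) (Real.exp_pos _).le)
        _ ≤ _ := by
            rw [one_mul]
            exact mul_le_mul_of_nonneg_left hexp (hnn x y)
    refine (Finset.sum_le_sum fun y _ => hpt y).trans ?_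
    rw [← Finset.sum_mul]
    refine mul_le_mul_of_nonneg_right ?_ (by positivity)
    exact Finset.single_le_sum (f := fun x => ∑ y, Real.exp (β * f y + h) * ξ y / ξ x)
      (fun z _ => Finset.sum_nonneg fun y _ => hnn z y) (Finset.mem_univ x)
end

section
/- For every 0 ≤ ε < 1 and β ≥ 0, the matrix A(0,β,0) equals the 2×2 matrix [[e^{−β} p(ε), e^{β}(1−p(ε))],[e^{−β}(1−p(ε)), e^{β} p(ε)]], and its Perron–Frobenius eigenvalue (spectral radius) is λ(β) = p(ε) cosh(β) + √(p(ε)² cosh²(β) − 2 p(ε) + 1). Consequently the annealed critical curve of this model is h_c^a(β) = −log( p(ε) cosh(β) + √(p(ε)² cosh²(β) − 2 p(ε) + 1) ). -/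
open Filter Topology Matrix

/-- The matrix `A(0,β,0)` for the two-state Markov chain on `{-1,+1}`
(indexed by `Fin 2`, with `0 ↔ -1` and `1 ↔ +1`) with transition matrix
`Q = [[ε, 1-ε],[1-ε, ε]]` and `f = id`:
`A(0,β,0)(x,y) = ∑_{t ≥ 1} K(t) Q^t(x,y) e^{β y}`. -/
noncomputable def A2 (K : ℕ → ℝ) (ε β : ℝ) : Matrix (Fin 2) (Fin 2) ℝ :=
  Matrix.of fun x y => ∑' t : ℕ,
    K (t + 1) * ((!![ε, 1 - ε; 1 - ε, ε] : Matrix (Fin 2) (Fin 2) ℝ) ^ (t + 1)) x y *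
      Real.exp (β * ![(-1 : ℝ), 1] y)

/-- For `0 ≤ ε < 1` and `β ≥ 0`, with
`p(ε) = ∑_{t ≥ 1} K(t)(1 + (2ε-1)^t)/2`, the matrix `A(0,β,0)` equals
`[[e^{-β} p(ε), e^{β}(1-p(ε))],[e^{-β}(1-p(ε)), e^{β} p(ε)]]`, and its
Perron–Frobenius eigenvalue (the eigenvalue `lam` admitting an entrywise
positive right eigenvector) is
`λ(β) = p(ε) cosh β + √(p(ε)² cosh² β - 2 p(ε) + 1)`; consequently the annealed
critical curve `h_c^a(β) = -log λ(β)` equals `-log(p(ε) cosh β + √(…))`. -/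
theorem statement7 (K : ℕ → ℝ) (hKpos : ∀ n, 1 ≤ n → 0 < K n)
    (hKsum : ∑' n : ℕ, K (n + 1) = 1)
    (ε : ℝ) (hε0 : 0 ≤ ε) (hε1 : ε < 1) (β : ℝ) (hβ : 0 ≤ β)
    (pε : ℝ) (hpε : pε = ∑' t : ℕ, K (t + 1) * (1 + (2 * ε - 1) ^ (t + 1)) / 2)
    (lam : ℝ)
    (hlam : ∃ ξ : Fin 2 → ℝ, (∀ i, 0 < ξ i) ∧ (A2 K ε β) *ᵥ ξ = lam • ξ) :
    A2 K ε β = !![Real.exp (-β) * pε, Real.exp β * (1 - pε);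
                  Real.exp (-β) * (1 - pε), Real.exp β * pε] ∧
    lam = pε * Real.cosh β + Real.sqrt (pε ^ 2 * Real.cosh β ^ 2 - 2 * pε + 1) ∧
    -Real.log lam =
      -Real.log (pε * Real.cosh β + Real.sqrt (pε ^ 2 * Real.cosh β ^ 2 - 2 * pε + 1)) := by
  have hsK : Summable (fun n : ℕ => K (n + 1)) := by
    by_contra h
    rw [tsum_eq_zero_of_not_summable h] at hKsum
    exact zero_ne_one hKsum
  have hK1 : HasSum (fun n : ℕ => K (n + 1)) 1 := hKsum ▸ hsK.hasSum
  have hq : |2 * ε - 1| ≤ 1 := abs_le.mpr ⟨by linarith, by linarith⟩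
  have hqt : ∀ t : ℕ, |(2 * ε - 1) ^ (t + 1)| ≤ 1 := fun t => by
    rw [abs_pow]; exact pow_le_one₀ (abs_nonneg _) hq
  have hsQ : Summable (fun t : ℕ => K (t + 1) * (2 * ε - 1) ^ (t + 1)) := by
    refine Summable.of_norm_bounded hsK fun t => ?_
    have h0 := hKpos (t + 1) (by omega)
    rw [Real.norm_eq_abs, abs_mul, abs_of_pos h0]
    exact mul_le_of_le_one_right h0.le (hqt t)
  obtain ⟨S, hS⟩ := hsQ
  have hP : HasSum (fun t : ℕ => K (t + 1) * ((1 + (2 * ε - 1) ^ (t + 1)) / 2)) ((1 + S) / 2) := by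
    refine ((hK1.add hS).div_const 2).congr_fun fun t => ?_
    ring
  have hM : HasSum (fun t : ℕ => K (t + 1) * ((1 - (2 * ε - 1) ^ (t + 1)) / 2)) ((1 - S) / 2) := by
    refine ((hK1.sub hS).div_const 2).congr_fun fun t => ?_
    ring
  have hp : pε = (1 + S) / 2 := by
    rw [hpε, ← hP.tsum_eq]
    exact tsum_congr fun t => by ring
  have hp' : 1 - pε = (1 - S) / 2 := by rw [hp]; ring
  have hp1 : 0 < 1 - pε := by
    rw [hp', ← hM.tsum_eq]
    refine hM.summable.tsum_pos (fun t => ?_) 0 ?_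
    · have h0 := hKpos (t + 1) (by omega)
      have := (abs_le.mp (hqt t)).2
      exact mul_nonneg h0.le (by linarith)
    · have h0 := hKpos (0 + 1) (by omega)
      refine mul_pos h0 ?_
      simp only [zero_add, pow_one]
      linarith
  have hpow : ∀ t : ℕ, (!![ε, 1 - ε; 1 - ε, ε] : Matrix (Fin 2) (Fin 2) ℝ) ^ t =
      !![(1 + (2 * ε - 1) ^ t) / 2, (1 - (2 * ε - 1) ^ t) / 2;
         (1 - (2 * ε - 1) ^ t) / 2, (1 + (2 * ε - 1) ^ t) / 2] := by
    intro t
    induction t with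
    | zero => ext i j; fin_cases i <;> fin_cases j <;> simp
    | succ n ih =>
      rw [pow_succ, ih]
      ext i j
      fin_cases i <;> fin_cases j <;> simp [Matrix.mul_apply, Fin.sum_univ_two] <;> ring
  have hA : A2 K ε β = !![Real.exp (-β) * pε, Real.exp β * (1 - pε);
                  Real.exp (-β) * (1 - pε), Real.exp β * pε] := by
    rw [hp', hp]
    ext i j
    simp only [A2, Matrix.of_apply, hpow]
    fin_cases i <;> fin_cases j <;> simp [tsum_mul_right, hP.tsum_eq, hM.tsum_eq] <;> ring
  have hl : lam = pε * Real.cosh β +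
      Real.sqrt (pε ^ 2 * Real.cosh β ^ 2 - 2 * pε + 1) := by
    obtain ⟨ξ, hpos, he⟩ := hlam
    rw [hA] at he
    have e0 := congrFun he 0
    have e1 := congrFun he 1
    simp [Matrix.mulVec, dotProduct, Fin.sum_univ_two] at e0 e1
    have x0 := hpos 0
    have y0 := hpos 1
    generalize ξ 0 = x at *
    generalize ξ 1 = y at *
    have hab : Real.exp (-β) * Real.exp β = 1 := by rw [← Real.exp_add]; simp
    have ha := Real.exp_pos (-β)
    have hb := Real.exp_pos β
    rw [Real.cosh_eq]
    generalize Real.exp (-β) = a at *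
    generalize Real.exp β = b at *
    have f0 : (lam - a * pε) * x = b * (1 - pε) * y := by linarith
    have f1 : (lam - b * pε) * y = a * (1 - pε) * x := by linarith
    have g0 : 0 < lam - a * pε := pos_of_mul_pos_left (f0 ▸ by positivity) x0.le
    have g1 : 0 < lam - b * pε := pos_of_mul_pos_left (f1 ▸ by positivity) y0.le
    have hdet : (lam - a * pε) * (lam - b * pε) = (1 - pε) ^ 2 := by
      have hxy : x * y ≠ 0 := by positivity
      apply mul_right_cancel₀ hxy
      calc _ = ((lam - a * pε) * x) * ((lam - b * pε) * y) := by ring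
        _ = (a * b) * ((1 - pε) ^ 2 * (x * y)) := by rw [f0, f1]; ring
        _ = _ := by rw [hab, one_mul]
    have hsq : pε ^ 2 * ((b + a) / 2) ^ 2 - 2 * pε + 1 = (lam - pε * ((b + a) / 2)) ^ 2 := by
      linear_combination (-1 : ℝ) * hdet + pε ^ 2 * hab
    rw [hsq, Real.sqrt_sq (by linarith)]
    ring
  exact ⟨hA, hl, by rw [← hl]⟩
end

section
/- For all a_0, a_1 ∈ ℝ and β ≥ 0, the Perron–Frobenius eigenvalue (spectral radius) of A(0,β,0) equals λ(β) = cosh(a_0 β) cosh(a_1 β) · ( 1 + K(1) ( cosh((a_0+a_1)β) / ( cosh(a_0 β) cosh(a_1 β) ) − 1 ) ), i.e. λ(β) = (1−K(1)) cosh(a_0 β) cosh(a_1 β) + K(1) cosh((a_0+a_1)β). -/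
open Filter Topology Matrix

/-- The transition matrix of `X_n = (ε_{n-1}, ε_n)` for i.i.d. uniform signs,
on the state space `{(-1,-1),(-1,+1),(+1,-1),(+1,+1)}` (indexed by `Fin 4` in
this order). -/
noncomputable def Q4 : Matrix (Fin 4) (Fin 4) ℝ :=
  !![1/2, 1/2, 0, 0; 0, 0, 1/2, 1/2; 1/2, 1/2, 0, 0; 0, 0, 1/2, 1/2]

/-- The function `f(x₀,x₁) = a₀ x₁ + a₁ x₀` on the four states. -/
noncomputable def f4 (a0 a1 : ℝ) : Fin 4 → ℝ :=
  ![-a0 - a1, a0 - a1, -a0 + a1, a0 + a1]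

/-- The matrix `A(0,β,0)(x,y) = ∑_{t ≥ 1} K(t) Q^t(x,y) e^{β f(y)}`. -/
noncomputable def A4 (K : ℕ → ℝ) (a0 a1 β : ℝ) : Matrix (Fin 4) (Fin 4) ℝ :=
  Matrix.of fun x y => ∑' t : ℕ,
    K (t + 1) * (Q4 ^ (t + 1)) x y * Real.exp (β * f4 a0 a1 y)

theorem Q4_sq : Q4 ^ 2 = Matrix.of fun _ _ => (1/4 : ℝ) := by
  rw [pow_two]
  ext i j
  fin_cases i <;> fin_cases j <;>
    simp [Q4, Matrix.mul_apply, Fin.sum_univ_four] <;> norm_num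

theorem Q4_pow (t : ℕ) : Q4 ^ (t + 2) = Matrix.of fun _ _ => (1/4 : ℝ) := by
  induction t with
  | zero => exact Q4_sq
  | succ t ih =>
    rw [show t + 1 + 2 = (t + 2) + 1 by ring, pow_succ, ih]
    ext i j
    fin_cases i <;> fin_cases j <;>
      simp [Q4, Matrix.mul_apply, Fin.sum_univ_four] <;> norm_num

theorem A4_apply (K : ℕ → ℝ) (hKsum : ∑' n : ℕ, K (n + 1) = 1) (a0 a1 β : ℝ) (x y : Fin 4) :
    A4 K a0 a1 β x y = (K 1 * Q4 x y + (1 - K 1) / 4) * Real.exp (β * f4 a0 a1 y) := by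
  have hs : Summable fun n : ℕ => K (n + 1) := by
    by_contra h
    rw [tsum_eq_zero_of_not_summable h] at hKsum
    norm_num at hKsum
  have hs' : Summable fun n : ℕ => K (n + 1 + 1) :=
    (summable_nat_add_iff (f := fun n : ℕ => K (n + 1)) 1).2 hs
  have h1 := hs.tsum_eq_zero_add
  rw [hKsum] at h1
  have e : ∀ t : ℕ, K (t + 1 + 1) * (Q4 ^ (t + 1 + 1)) x y = K (t + 1 + 1) * (1/4) := by
    intro t
    rw [Q4_pow]
    rfl
  have hs2 : Summable fun t : ℕ => K (t + 1) * (Q4 ^ (t + 1)) x y := by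
    rw [← summable_nat_add_iff 1]
    simp only [e]
    exact hs'.mul_right _
  have : A4 K a0 a1 β x y
      = ∑' t : ℕ, K (t + 1) * (Q4 ^ (t + 1)) x y * Real.exp (β * f4 a0 a1 y) := rfl
  rw [this, tsum_mul_right, hs2.tsum_eq_zero_add]
  simp only [e]
  rw [tsum_mul_right]
  simp only [zero_add, pow_one] at h1 ⊢
  have h2 : ∑' b : ℕ, K (b + 1 + 1) = 1 - K 1 := by linarith
  rw [h2]
  ring

/-- For all `a₀, a₁ ∈ ℝ` and `β ≥ 0`, the Perron–Frobenius
eigenvalue of `A(0,β,0)` (the eigenvalue `lam` admitting an entrywise positive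
right eigenvector) equals
`cosh(a₀β) cosh(a₁β) (1 + K(1)(cosh((a₀+a₁)β)/(cosh(a₀β) cosh(a₁β)) - 1))`,
i.e. `(1-K(1)) cosh(a₀β) cosh(a₁β) + K(1) cosh((a₀+a₁)β)`. -/
theorem statement8 (K : ℕ → ℝ) (hKpos : ∀ n, 1 ≤ n → 0 < K n)
    (hKsum : ∑' n : ℕ, K (n + 1) = 1)
    (a0 a1 β : ℝ) (hβ : 0 ≤ β)
    (lam : ℝ)
    (hlam : ∃ ξ : Fin 4 → ℝ, (∀ i, 0 < ξ i) ∧ (A4 K a0 a1 β) *ᵥ ξ = lam • ξ) :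
    lam = Real.cosh (a0 * β) * Real.cosh (a1 * β) *
        (1 + K 1 * (Real.cosh ((a0 + a1) * β) /
          (Real.cosh (a0 * β) * Real.cosh (a1 * β)) - 1)) ∧
    lam = (1 - K 1) * Real.cosh (a0 * β) * Real.cosh (a1 * β) +
        K 1 * Real.cosh ((a0 + a1) * β) := by
  have key : lam = (1 - K 1) * Real.cosh (a0 * β) * Real.cosh (a1 * β) +
        K 1 * Real.cosh ((a0 + a1) * β) := by
    obtain ⟨ξ, hξ, h⟩ := hlam
    have h0 := congrFun h 0
    have h1 := congrFun h 1
    have h2 := congrFun h 2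
    have h3 := congrFun h 3
    simp only [Matrix.mulVec, dotProduct, Fin.sum_univ_four, A4_apply K hKsum, Pi.smul_apply,
      smul_eq_mul] at h0 h1 h2 h3
    simp [Q4, f4] at h0 h1 h2 h3
    have hk : 0 < K 1 := hKpos 1 le_rfl
    have hk1 : K 1 ≤ 1 := by
      have hs : Summable fun n : ℕ => K (n + 1) := by
        by_contra h
        rw [tsum_eq_zero_of_not_summable h] at hKsum
        norm_num at hKsum
      rw [← hKsum]
      exact hs.le_tsum 0 (fun j _ => (hKpos _ (by omega)).le)
    have x0 := hξ 0
    have x1 := hξ 1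
    have x2 := hξ 2
    have x3 := hξ 3
    have c0 : Real.cosh (a0 * β) = (Real.exp (a0 * β) + (Real.exp (a0 * β))⁻¹) / 2 := by
      rw [Real.cosh_eq, Real.exp_neg]
    have c1 : Real.cosh (a1 * β) = (Real.exp (a1 * β) + (Real.exp (a1 * β))⁻¹) / 2 := by
      rw [Real.cosh_eq, Real.exp_neg]
    have c2 : Real.cosh ((a0 + a1) * β) = (Real.exp (a0 * β) * Real.exp (a1 * β) +
        (Real.exp (a0 * β))⁻¹ * (Real.exp (a1 * β))⁻¹) / 2 := by
      rw [Real.cosh_eq, ← Real.exp_neg, ← Real.exp_neg, ← Real.exp_add, ← Real.exp_add]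
      ring_nf
    have e0 : Real.exp (β * (-a0 - a1)) = (Real.exp (a0 * β))⁻¹ * (Real.exp (a1 * β))⁻¹ := by
      rw [← Real.exp_neg, ← Real.exp_neg, ← Real.exp_add]; ring_nf
    have e1 : Real.exp (β * (a0 - a1)) = Real.exp (a0 * β) * (Real.exp (a1 * β))⁻¹ := by
      rw [← Real.exp_neg, ← Real.exp_add]; ring_nf
    have e2 : Real.exp (β * (-a0 + a1)) = (Real.exp (a0 * β))⁻¹ * Real.exp (a1 * β) := by
      rw [← Real.exp_neg, ← Real.exp_add]; ring_nf
    have e3 : Real.exp (β * (a0 + a1)) = Real.exp (a0 * β) * Real.exp (a1 * β) := by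
      rw [← Real.exp_add]; ring_nf
    rw [c0, c1, c2]
    rw [e0, e1, e2, e3] at h0 h1 h2 h3
    have hp := Real.exp_pos (a0 * β)
    have hq := Real.exp_pos (a1 * β)
    have hp' : Real.exp (a0 * β) * (Real.exp (a0 * β))⁻¹ = 1 := mul_inv_cancel₀ hp.ne'
    have hq' : Real.exp (a1 * β) * (Real.exp (a1 * β))⁻¹ = 1 := mul_inv_cancel₀ hq.ne'
    have hpi := inv_pos.2 hp
    have hqi := inv_pos.2 hq
    generalize Real.exp (a0 * β) = p at *
    generalize Real.exp (a1 * β) = q at *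
    generalize p⁻¹ = p' at *
    generalize q⁻¹ = q' at *
    generalize K 1 = k at *
    generalize ξ 0 = u at *
    generalize ξ 1 = v at *
    generalize ξ 2 = u' at *
    generalize ξ 3 = v' at *
    have hk' : 0 ≤ 1 - k := by linarith
    have hl : 0 < lam := by
      have : 0 < lam * u := by
        rw [← h0]
        positivity
      exact pos_of_mul_pos_left this x0.le
    have hu : u' = u := mul_left_cancel₀ hl.ne' (by rw [← h0, ← h2])
    have hv : v' = v := mul_left_cancel₀ hl.ne' (by rw [← h1, ← h3])
    subst hu hv
    have huv : u' * v' ≠ 0 := by positivity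
    set m11 := (1+k)/4 * (p'*q') + (1-k)/4*(p'*q) with hm11
    set m12 := (1+k)/4 * (p*q') + (1-k)/4*(p*q) with hm12
    set m21 := (1-k)/4 * (p'*q') + (1+k)/4*(p'*q) with hm21
    set m22 := (1-k)/4 * (p*q') + (1+k)/4*(p*q) with hm22
    have g1 : (lam - m11) * u' = m12 * v' := by rw [hm11, hm12]; linear_combination -h0
    have g2 : (lam - m22) * v' = m21 * u' := by rw [hm21, hm22]; linear_combination -h1
    have g3 : (lam - m11) * (lam - m22) = m12 * m21 := by
      apply mul_right_cancel₀ huv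
      linear_combination (lam - m22) * v' * g1 + m12 * v' * g2
    have det : m11 * m22 = m12 * m21 := by
      rw [hm11, hm12, hm21, hm22]
      ring
    have : lam = m11 + m22 := by
      apply mul_left_cancel₀ hl.ne'
      linear_combination g3 - det
    rw [this, hm11, hm22]
    ring
  refine ⟨?_, key⟩
  have h0 := Real.cosh_pos (a0 * β)
  have h1 := Real.cosh_pos (a1 * β)
  rw [key]
  field_simp
  ring
end
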